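/- arXiv:1102.4065 — 2 statements merged into one kernel-verified Lean document; each statement's English description precedes it below -/
import Mathlib

section
/- Let k ∈ ℕ, n ≥ 1, and suppose δ ≠ 1 + (2k - l - 1)/(n+1) for all 1 ≤ l ≤ k. Define coefficients c^k_0 = 1 and c^k_m = (ℓ_{k-m}(λ)/d^k_m(δ))·c^k_{m-1}, where ℓ_j(λ) = -(j + λ(n+1)) and d^k_m(δ) = m(-2k + m + 1 + (δ-1)(n+1)). Then the map Q = Σ_{m=0}^k c^k_m D^m (composed with normal ordering) is the unique projectively equivariant quantization on symbols of degree k, i.e. it intertwines L^δ with the adjoint action 𝓛^{λ,μ} for all X ∈ sl_{n+1}, where μ = λ + δ. -/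
open MvPolynomial

noncomputable section

/-- Polynomial symbols: polynomial functions on `T*ℝⁿ`; `Sum.inl` are the `x` variables,
`Sum.inr` the fiber variables `p`. -/
abbrev PolySym (n : ℕ) := MvPolynomial (Fin n ⊕ Fin n) ℝ

/-- Polynomial functions on `ℝⁿ` (densities are identified with these). -/
abbrev PolyDen (n : ℕ) := MvPolynomial (Fin n) ℝ

/-- Polynomial vector fields on `ℝⁿ`, given by their components. -/
abbrev PolyVF (n : ℕ) := Fin n → PolyDen n

/-- `∂/∂x^i` on symbols. -/
def dxOp (n : ℕ) (i : Fin n) : Module.End ℝ (PolySym n) := (pderiv (Sum.inl i)).toLinearMap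

/-- `∂/∂p_i` on symbols. -/
def dpOp (n : ℕ) (i : Fin n) : Module.End ℝ (PolySym n) := (pderiv (Sum.inr i)).toLinearMap

/-- Multiplication by a symbol. -/
def mulOp (n : ℕ) (q : PolySym n) : Module.End ℝ (PolySym n) := LinearMap.mulLeft ℝ q

/-- The symbol `x^i`. -/
def xVar (n : ℕ) (i : Fin n) : PolySym n := X (Sum.inl i)

/-- The symbol `p_i`. -/
def pVar (n : ℕ) (i : Fin n) : PolySym n := X (Sum.inr i)

/-- A polynomial in `x` viewed as a symbol. -/
def liftX (n : ℕ) (f : PolyDen n) : PolySym n := rename Sum.inl f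

/-- Divergence of a vector field. -/
def divVF (n : ℕ) (Xf : PolyVF n) : PolyDen n := ∑ i, pderiv i (Xf i)

/-- Weight function computing the degree in the `p` variables. -/
def pwt (n : ℕ) : Fin n ⊕ Fin n → ℕ := Sum.elim (fun _ => 0) (fun _ => 1)

/-- Homogeneity of degree `k` in the fiber variables `p`. -/
def IsPHomog (n : ℕ) (P : PolySym n) (k : ℕ) : Prop := IsWeightedHomogeneous (pwt n) P k

/-- The weight-`δ` action `L^δ_X = X^i ∂_{x^i} - p_j (∂_{x^i} X^j) ∂_{p_i} + δ Div(X)` of a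
vector field on symbols. -/
def Lop (n : ℕ) (δ : ℝ) (Xf : PolyVF n) : Module.End ℝ (PolySym n) :=
  (∑ i, mulOp n (liftX n (Xf i)) ∘ₗ dxOp n i)
    - (∑ i, ∑ j, mulOp n (pVar n j * liftX n (pderiv i (Xf j))) ∘ₗ dpOp n i)
    + δ • mulOp n (liftX n (divVF n Xf))

/-- The action `ℓ^λ_X = X + λ Div(X)` of a vector field on `λ`-densities. -/
def ellOp (n : ℕ) (lam : ℝ) (Xf : PolyVF n) : Module.End ℝ (PolyDen n) :=
  (∑ i, LinearMap.mulLeft ℝ (Xf i) ∘ₗ (pderiv i).toLinearMap)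
    + lam • LinearMap.mulLeft ℝ (divVF n Xf)

/-- Lie bracket of polynomial vector fields. -/
def bracketVF (n : ℕ) (Xf Yf : PolyVF n) : PolyVF n :=
  fun i => ∑ j, (Xf j * pderiv j (Yf i) - Yf j * pderiv j (Xf i))
/-- The projective inversion `X^i = x^i x^j ∂_j`. -/
def projVF (n : ℕ) (i : Fin n) : PolyVF n := fun j => X i * X j

/-- The divergence operator `D = ∂_{x^i} ∂_{p_i}` on symbols. -/
def divOp (n : ℕ) : Module.End ℝ (PolySym n) := ∑ i, dxOp n i ∘ₗ dpOp n i

/-- Generators of the projective algebra `sl_{n+1}`: affine vector fields together with the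
projective inversions. -/
def projGenSet (n : ℕ) : Set (PolyVF n) :=
  {Xf | ∀ i, (Xf i).totalDegree ≤ 1} ∪ Set.range (projVF n)
/-- Exponents of the `x`-part of a symbol monomial. -/
def xExp (n : ℕ) (m : (Fin n ⊕ Fin n) →₀ ℕ) : Fin n →₀ ℕ :=
  Finsupp.comapDomain Sum.inl m Sum.inl_injective.injOn

/-- Exponents of the `p`-part of a symbol monomial. -/
def pExp (n : ℕ) (m : (Fin n ⊕ Fin n) →₀ ℕ) : Fin n →₀ ℕ :=
  Finsupp.comapDomain Sum.inr m Sum.inr_injective.injOn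

/-- The iterated partial derivative `∂^b f` of a polynomial on `ℝⁿ`. -/
def derivMulti (n : ℕ) (b : Fin n →₀ ℕ) (f : PolyDen n) : PolyDen n :=
  ∑ c ∈ f.support, (f.coeff c * ∏ i, (Nat.descFactorial (c i) (b i) : ℝ)) • monomial (c - b) 1

/-- Normal ordering: the differential operator associated to a symbol, sending the monomial
`x^a p^b` to the operator `x^a ∂^b`. -/
def Nord (n : ℕ) (P : PolySym n) (f : PolyDen n) : PolyDen n :=
  ∑ m ∈ P.support, P.coeff m • (monomial (xExp n m) 1 * derivMulti n (pExp n m) f)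

/-- A projectively equivariant quantization on degree-`k` symbols, expressed through the
normal ordering: a linear operator `Φ` on symbols such that (i) `Φ` is a right inverse of the
principal symbol map, i.e. on `p`-homogeneous `P` of degree `k` the difference `Φ P - P` only
has components of `p`-degree `< k`, and (ii) `N ∘ Φ` intertwines the symbol action `L^δ` with
the adjoint action `𝓛^{λ,μ}` (`μ = λ + δ`) for every `X ∈ sl_{n+1}`. -/
def IsProjEquivQuant (n k : ℕ) (δ lam : ℝ) (Φ : Module.End ℝ (PolySym n)) : Prop :=
  (∀ P : PolySym n, IsPHomog n P k → ∀ d, k ≤ d →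
    weightedHomogeneousComponent (pwt n) d (Φ P - P) = 0) ∧
  (∀ Xf ∈ projGenSet n, ∀ P : PolySym n, IsPHomog n P k → ∀ f : PolyDen n,
    Nord n (Φ (Lop n δ Xf P)) f
      = ellOp n (lam + δ) Xf (Nord n (Φ P) f) - Nord n (Φ P) (ellOp n lam Xf f))

/-! ### Elementary operators on symbols -/

abbrev dx {n : ℕ} (i : Fin n) (P : PolySym n) : PolySym n := pderiv (Sum.inl i) P
abbrev dp {n : ℕ} (i : Fin n) (P : PolySym n) : PolySym n := pderiv (Sum.inr i) P
abbrev xv {n : ℕ} (i : Fin n) : PolySym n := X (Sum.inl i)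
abbrev pv {n : ℕ} (i : Fin n) : PolySym n := X (Sum.inr i)

def euX {n : ℕ} (P : PolySym n) : PolySym n := ∑ j, xv j * dx j P
def euP {n : ℕ} (P : PolySym n) : PolySym n := ∑ j, pv j * dp j P
def divF {n : ℕ} (P : PolySym n) : PolySym n := ∑ j, dx j (dp j P)
def pxS (n : ℕ) : PolySym n := ∑ j, pv j * xv j

theorem pderiv_comm' {σ : Type*} (i j : σ) (P : MvPolynomial σ ℝ) :
    pderiv i (pderiv j P) = pderiv j (pderiv i P) := by
  classical
  let a : Derivation ℝ (MvPolynomial σ ℝ) (MvPolynomial σ ℝ) := pderiv i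
  let b : Derivation ℝ (MvPolynomial σ ℝ) (MvPolynomial σ ℝ) := pderiv j
  have h : ⁅a, b⁆ = 0 := by
    apply derivation_ext
    intro k
    simp [a, b, Derivation.commutator_apply, pderiv_X, Pi.single_apply, apply_ite]
  have := congrArg (fun d => d P) h
  simpa [a, b, Derivation.commutator_apply, sub_eq_zero] using this

section
variable {n : ℕ}

theorem dx_xv (i j : Fin n) : dx i (xv j) = if i = j then 1 else 0 := by
  simp [dx, xv, pderiv_X, Pi.single_apply, eq_comm]
theorem dp_pv (i j : Fin n) : dp i (pv j) = if i = j then 1 else 0 := by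
  simp [dp, pv, pderiv_X, Pi.single_apply, eq_comm]
theorem dx_pv (i j : Fin n) : dx i (pv j) = 0 := by
  simp [dx, pv, pderiv_X]
theorem dp_xv (i j : Fin n) : dp i (xv j) = 0 := by
  simp [dp, xv, pderiv_X]

theorem dx_mul (i : Fin n) (P Q : PolySym n) : dx i (P * Q) = dx i P * Q + P * dx i Q := pderiv_mul
theorem dp_mul (i : Fin n) (P Q : PolySym n) : dp i (P * Q) = dp i P * Q + P * dp i Q := pderiv_mul

theorem euX_add (P Q : PolySym n) : euX (P + Q) = euX P + euX Q := by
  simp [euX, mul_add, Finset.sum_add_distrib]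
theorem euP_add (P Q : PolySym n) : euP (P + Q) = euP P + euP Q := by
  simp [euP, mul_add, Finset.sum_add_distrib]
theorem divF_add (P Q : PolySym n) : divF (P + Q) = divF P + divF Q := by
  simp [divF, Finset.sum_add_distrib]
theorem divF_sub (P Q : PolySym n) : divF (P - Q) = divF P - divF Q := by
  simp [divF, Finset.sum_sub_distrib]
theorem divF_C_mul (a : ℝ) (P : PolySym n) : divF (C a * P) = C a * divF P := by
  simp [divF, Finset.mul_sum]
theorem euP_C_mul (a : ℝ) (P : PolySym n) : euP (C a * P) = C a * euP P := by
  simp only [euP, dp, pderiv_C_mul, Finset.mul_sum]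
  exact Finset.sum_congr rfl fun i _ => by ring

theorem divOp_apply (P : PolySym n) : divOp n P = divF P := by
  simp [divOp, divF, dxOp, dpOp]

theorem dx_euX (i : Fin n) (P : PolySym n) : dx i (euX P) = euX (dx i P) + dx i P := by
  simp only [euX, map_sum, pderiv_mul, Finset.sum_add_distrib, pderiv_comm' (Sum.inl i) (Sum.inl _) P]
  simp only [dx_xv, ite_mul, one_mul, zero_mul, Finset.sum_ite_eq, Finset.mem_univ, if_true]
  ring
theorem dp_euX (i : Fin n) (P : PolySym n) : dp i (euX P) = euX (dp i P) := by
  simp only [euX, map_sum, pderiv_mul, Finset.sum_add_distrib, pderiv_comm' (Sum.inr i) (Sum.inl _) P]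
  simp only [dp_xv, zero_mul, Finset.sum_const_zero, zero_add]
theorem dp_euP (i : Fin n) (P : PolySym n) : dp i (euP P) = euP (dp i P) + dp i P := by
  simp only [euP, map_sum, pderiv_mul, Finset.sum_add_distrib, pderiv_comm' (Sum.inr i) (Sum.inr _) P]
  simp only [dp_pv, ite_mul, one_mul, zero_mul, Finset.sum_ite_eq, Finset.mem_univ, if_true]
  ring
theorem dx_euP (i : Fin n) (P : PolySym n) : dx i (euP P) = euP (dx i P) := by
  simp only [euP, map_sum, pderiv_mul, Finset.sum_add_distrib, pderiv_comm' (Sum.inl i) (Sum.inr _) P]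
  simp only [dx_pv, zero_mul, Finset.sum_const_zero, zero_add]
theorem dx_divF (i : Fin n) (P : PolySym n) : dx i (divF P) = divF (dx i P) := by
  simp only [divF, map_sum, pderiv_comm' (Sum.inl i)]
theorem dp_divF (i : Fin n) (P : PolySym n) : dp i (divF P) = divF (dp i P) := by
  simp only [divF, map_sum, pderiv_comm' (Sum.inr i)]

theorem dx_pxS (i : Fin n) : dx i (pxS n) = pv i := by
  simp only [pxS, map_sum, pderiv_mul, dx_pv, dx_xv]
  simp
theorem dp_pxS (i : Fin n) : dp i (pxS n) = xv i := by
  simp only [pxS, map_sum, pderiv_mul, dp_pv, dp_xv]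
  simp

theorem divF_xv_mul (i : Fin n) (P : PolySym n) : divF (xv i * P) = xv i * divF P + dp i P := by
  simp only [divF, dp_mul, dp_xv, zero_mul, zero_add, dx_mul, dx_xv, Finset.sum_add_distrib,
    Finset.mul_sum]
  simp [add_comm]
theorem divF_pv_mul (i : Fin n) (P : PolySym n) : divF (pv i * P) = pv i * divF P + dx i P := by
  simp only [divF, dp_mul, dp_pv, map_add, dx_mul, dx_pv, Finset.sum_add_distrib,
    Finset.mul_sum]
  simp [add_comm, apply_ite]
theorem divF_pxS_mul (P : PolySym n) :
    divF (pxS n * P) = pxS n * divF P + (euX P + euP P + (n : PolySym n) * P) := by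
  simp only [divF, dp_mul, dp_pxS, map_add, dx_mul, dx_pxS, dx_xv, Finset.sum_add_distrib,
    Finset.mul_sum, euX, euP]
  simp
  ring
theorem divF_euX (P : PolySym n) : divF (euX P) = euX (divF P) + divF P := by
  simp only [divF, dp_euX, dx_euX, Finset.sum_add_distrib]
  congr 1
  simp only [euX, map_sum, Finset.mul_sum]
  rw [Finset.sum_comm]
theorem divF_euP (P : PolySym n) : divF (euP P) = euP (divF P) + divF P := by
  simp only [divF, dp_euP, map_add, dx_euP, Finset.sum_add_distrib]
  congr 1
  simp only [euP, map_sum, Finset.mul_sum]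
  rw [Finset.sum_comm]

/-! ### The Lie derivative on generators -/

theorem Lop_apply (δ : ℝ) (Xf : PolyVF n) (P : PolySym n) :
    Lop n δ Xf P = (∑ i, liftX n (Xf i) * dx i P)
      - (∑ i, ∑ j, pv j * liftX n (pderiv i (Xf j)) * dp i P)
      + C δ * (liftX n (divVF n Xf) * P) := by
  simp [Lop, mulOp, dxOp, dpOp, pVar, smul_eq_C_mul, mul_assoc]

theorem Lop_add (δ : ℝ) (Xf Yf : PolyVF n) (P : PolySym n) :
    Lop n δ (Xf + Yf) P = Lop n δ Xf P + Lop n δ Yf P := by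
  simp only [Lop_apply, Pi.add_apply, liftX, map_add, add_mul, mul_add, Finset.sum_add_distrib, divVF]
  ring
theorem Lop_smul (δ : ℝ) (a : ℝ) (Xf : PolyVF n) (P : PolySym n) :
    Lop n δ (a • Xf) P = C a * Lop n δ Xf P := by
  have h1 : ∑ i, liftX n ((a • Xf) i) * dx i P = C a * ∑ i, liftX n (Xf i) * dx i P := by
    rw [Finset.mul_sum]
    refine Finset.sum_congr rfl fun i _ => ?_
    simp only [Pi.smul_apply, liftX, smul_eq_C_mul, map_mul, rename_C, mul_assoc]
  have h2 : ∑ i, ∑ j, pv j * liftX n (pderiv i ((a • Xf) j)) * dp i P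
      = C a * ∑ i, ∑ j, pv j * liftX n (pderiv i (Xf j)) * dp i P := by
    simp only [Finset.mul_sum]
    refine Finset.sum_congr rfl fun i _ => Finset.sum_congr rfl fun j _ => ?_
    simp only [Pi.smul_apply, liftX, smul_eq_C_mul, map_mul, rename_C, pderiv_C_mul]
    ring
  have h3 : liftX n (divVF n (a • Xf)) = C a * liftX n (divVF n Xf) := by
    simp only [divVF, Pi.smul_apply, liftX, smul_eq_C_mul, map_mul, rename_C, pderiv_C_mul,
      ← Finset.mul_sum]
  rw [Lop_apply, Lop_apply, h1, h2, h3]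
  ring

theorem ellOp_apply (lam : ℝ) (Xf : PolyVF n) (f : PolyDen n) :
    ellOp n lam Xf f = (∑ i, Xf i * pderiv i f) + C lam * (divVF n Xf * f) := by
  simp [ellOp, smul_eq_C_mul]

theorem ellOp_add (lam : ℝ) (Xf Yf : PolyVF n) (f : PolyDen n) :
    ellOp n lam (Xf + Yf) f = ellOp n lam Xf f + ellOp n lam Yf f := by
  simp only [ellOp_apply, Pi.add_apply, map_add, add_mul, mul_add, Finset.sum_add_distrib, divVF]
  ring
theorem ellOp_smul (lam a : ℝ) (Xf : PolyVF n) (f : PolyDen n) :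
    ellOp n lam (a • Xf) f = C a * ellOp n lam Xf f := by
  simp only [ellOp_apply, Pi.smul_apply, smul_eq_C_mul, pderiv_C_mul, divVF,
    ← Finset.mul_sum, mul_add, mul_assoc]
  ring

abbrev cVF (b : Fin n) : PolyVF n := Pi.single b 1
abbrev lVF (a b : Fin n) : PolyVF n := Pi.single b (X a)

theorem Lop_cVF (δ : ℝ) (b : Fin n) (P : PolySym n) : Lop n δ (cVF b) P = dx b P := by
  simp [Lop_apply, Pi.single_apply, divVF, liftX, apply_ite]

theorem Lop_lVF (δ : ℝ) (a b : Fin n) (P : PolySym n) :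
    Lop n δ (lVF a b) P = xv a * dx b P - pv b * dp a P + C δ * ((if a = b then 1 else 0) * P) := by
  simp [Lop_apply, Pi.single_apply, divVF, liftX, apply_ite, pderiv_X]
  split_ifs <;> simp_all

theorem Lop_projVF (δ : ℝ) (i : Fin n) (P : PolySym n) :
    Lop n δ (projVF n i) P = xv i * euX P - pxS n * dp i P - xv i * euP P
      + C (δ * (n + 1)) * (xv i * P) := by
  have h1 : divVF n (projVF n i) = C ((n : ℝ) + 1) * X i := by
    simp [divVF, projVF, pderiv_X, Pi.single_apply, Finset.sum_add_distrib]
    ring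
  have h2 : ∑ a, ∑ j, pv j * liftX n (pderiv a (projVF n i j)) * dp a P
      = pxS n * dp i P + xv i * euP P := by
    have h3 : ∀ a j : Fin n, pv j * liftX n (pderiv a (projVF n i j)) * dp a P
        = (if a = i then pv j * xv j * dp a P else 0)
          + (if a = j then xv i * (pv j * dp a P) else 0) := by
      intro a j
      have : pderiv a (projVF n i j) = (if a = i then X j else 0) + (if a = j then X i else 0) := by
        simp [projVF, pderiv_X, Pi.single_apply, eq_comm]
        ring
      rw [this]
      simp only [liftX, map_add]
      split_ifs <;> simp <;> ring
    simp only [h3, Finset.sum_add_distrib]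
    rw [Finset.sum_comm]
    simp [euP, pxS, Finset.mul_sum, Finset.sum_mul]
  rw [Lop_apply, h1, h2]
  simp only [projVF, liftX, map_mul, rename_X, rename_C, euX, Finset.mul_sum, mul_assoc]
  ring

theorem divF_Lop_cVF (δ : ℝ) (b : Fin n) (P : PolySym n) :
    divF (Lop n δ (cVF b) P) = Lop n δ (cVF b) (divF P) := by
  rw [Lop_cVF, Lop_cVF, dx_divF]

theorem divF_Lop_lVF (δ : ℝ) (a b : Fin n) (P : PolySym n) :
    divF (Lop n δ (lVF a b) P) = Lop n δ (lVF a b) (divF P) := by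
  rw [Lop_lVF, Lop_lVF, divF_add, divF_sub, divF_xv_mul, divF_pv_mul, divF_C_mul, dx_divF, dp_divF]
  have : dp a (dx b P) = dx b (dp a P) := pderiv_comm' _ _ _
  rw [this]
  split_ifs
  · simp only [one_mul]; ring
  · simp [divF]

theorem divF_Lop_projVF (δ : ℝ) (i : Fin n) (P : PolySym n) :
    divF (Lop n δ (projVF n i) P) = Lop n δ (projVF n i) (divF P)
      + (C ((δ - 1) * (n + 1)) * dp i P - 2 * euP (dp i P)) := by
  rw [Lop_projVF, Lop_projVF]
  simp only [divF_add, divF_sub, divF_xv_mul, divF_pxS_mul, divF_C_mul, divF_euX, divF_euP, dp_euX,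
    dp_euP, dp_divF]
  simp only [map_mul, map_add, map_sub, map_natCast, map_one]
  ring

end

/-! ### Normal ordering -/

theorem exists_lin {σ M : Type*} [AddCommGroup M] [Module ℝ M] (F : (σ →₀ ℕ) → M) :
    ∃ G : MvPolynomial σ ℝ →ₗ[ℝ] M, (∀ m, G (monomial m 1) = F m) ∧
      ∀ f, G f = ∑ m ∈ f.support, f.coeff m • F m := by
  have h0 : ∀ m, (basisMonomials σ ℝ).constr ℝ F (monomial m 1) = F m := by
    intro m
    have := (basisMonomials σ ℝ).constr_basis ℝ F m
    simpa using this
  refine ⟨(basisMonomials σ ℝ).constr ℝ F, h0, fun f => ?_⟩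
  conv_lhs => rw [f.as_sum]
  rw [map_sum]
  refine Finset.sum_congr rfl fun m _ => ?_
  rw [← h0 m, ← map_smul, smul_monomial, smul_eq_mul, mul_one]

section
variable {n : ℕ}

theorem derivMulti_lin (b : Fin n →₀ ℕ) : ∃ G : PolyDen n →ₗ[ℝ] PolyDen n,
    (∀ f, derivMulti n b f = G f) ∧
    ∀ c, G (monomial c 1) = (∏ i, (Nat.descFactorial (c i) (b i) : ℝ)) • monomial (c - b) 1 := by
  obtain ⟨G, h1, h2⟩ := exists_lin (σ := Fin n)
    (fun c => (∏ i, (Nat.descFactorial (c i) (b i) : ℝ)) • (monomial (c - b) 1 : PolyDen n))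
  exact ⟨G, fun f => by simp only [h2, derivMulti, smul_smul], h1⟩

theorem derivMulti_one (b : Fin n →₀ ℕ) : derivMulti n b 1 = if b = 0 then 1 else 0 := by
  obtain ⟨G, h1, h2⟩ := derivMulti_lin b
  have : (1 : PolyDen n) = monomial 0 1 := rfl
  rw [h1, this, h2]
  split_ifs with h
  · subst h; simp
  · obtain ⟨i, hi⟩ := Finsupp.ne_iff.mp h
    have : (∏ i, (Nat.descFactorial ((0 : Fin n →₀ ℕ) i) (b i) : ℝ)) = 0 := by
      apply Finset.prod_eq_zero (Finset.mem_univ i)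
      simp only [Finsupp.coe_zero, Pi.zero_apply] at hi ⊢
      rw [Nat.cast_eq_zero, Nat.descFactorial_eq_zero_iff_lt]
      omega
    rw [this, zero_smul]

theorem derivMulti_zero' (f : PolyDen n) : derivMulti n 0 f = f := by
  obtain ⟨G, h1, h2⟩ := derivMulti_lin (0 : Fin n →₀ ℕ)
  have : G = LinearMap.id := by
    apply (basisMonomials (Fin n) ℝ).ext
    intro c
    simp [h2]
  rw [h1, this]; rfl

theorem derivMulti_add_single (b : Fin n →₀ ℕ) (i : Fin n) (f : PolyDen n) :
    derivMulti n (b + Finsupp.single i 1) f = derivMulti n b (pderiv i f) := by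
  obtain ⟨G, h1, h2⟩ := derivMulti_lin b
  obtain ⟨G', h1', h2'⟩ := derivMulti_lin (b + Finsupp.single i 1)
  have : G' = G ∘ₗ (pderiv i).toLinearMap := by
    apply (basisMonomials (Fin n) ℝ).ext
    intro c
    simp only [coe_basisMonomials, LinearMap.comp_apply,
      Derivation.coeFn_coe, pderiv_monomial, h2']
    rw [show (monomial (c - Finsupp.single i 1) (1 * (c i : ℝ)) : PolyDen n)
      = (c i : ℝ) • monomial (c - Finsupp.single i 1) 1 by simp [smul_monomial], map_smul, h2,
      smul_smul]
    congr 1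
    · rw [← Finset.mul_prod_erase _ _ (Finset.mem_univ i),
        ← Finset.mul_prod_erase _ (fun j => (Nat.descFactorial ((c - Finsupp.single i 1 : Fin n →₀ ℕ) j) (b j) : ℝ))
          (Finset.mem_univ i), ← mul_assoc]
      congr 1
      · simp only [Finsupp.add_apply, Finsupp.single_eq_same, Finsupp.tsub_apply]
        rcases Nat.eq_zero_or_pos (c i) with h | h
        · simp [h]
        · obtain ⟨d, hd⟩ := Nat.exists_eq_succ_of_ne_zero h.ne'
          rw [hd, Nat.succ_eq_add_one, Nat.succ_descFactorial_succ]
          push_cast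
          simp
      · refine Finset.prod_congr rfl fun j hj => ?_
        have hj' : j ≠ i := Finset.ne_of_mem_erase hj
        simp [Finsupp.single_apply, hj'.symm]
    · congr 1
      rw [add_comm, tsub_add_eq_tsub_tsub]
  rw [h1, h1', this]; rfl

theorem derivMulti_add (b : Fin n →₀ ℕ) (f g : PolyDen n) :
    derivMulti n b (f + g) = derivMulti n b f + derivMulti n b g := by
  obtain ⟨G, h1, h2⟩ := derivMulti_lin b
  simp [h1]
theorem derivMulti_smul (b : Fin n →₀ ℕ) (a : ℝ) (f : PolyDen n) :
    derivMulti n b (a • f) = a • derivMulti n b f := by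
  obtain ⟨G, h1, h2⟩ := derivMulti_lin b
  simp [h1]

theorem Nord_lin (f : PolyDen n) : ∃ G : PolySym n →ₗ[ℝ] PolyDen n,
    (∀ P, Nord n P f = G P) ∧
    ∀ m, G (monomial m 1) = monomial (xExp n m) 1 * derivMulti n (pExp n m) f := by
  obtain ⟨G, h1, h2⟩ := exists_lin (σ := Fin n ⊕ Fin n)
    (fun m => (monomial (xExp n m) 1 * derivMulti n (pExp n m) f : PolyDen n))
  exact ⟨G, fun f => by simp only [h2, Nord], h1⟩

theorem Nord_add (P Q : PolySym n) (f : PolyDen n) :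
    Nord n (P + Q) f = Nord n P f + Nord n Q f := by
  obtain ⟨G, h1, h2⟩ := Nord_lin f
  simp [h1]
theorem Nord_sub (P Q : PolySym n) (f : PolyDen n) :
    Nord n (P - Q) f = Nord n P f - Nord n Q f := by
  obtain ⟨G, h1, h2⟩ := Nord_lin f
  simp [h1]
theorem Nord_sum {ι : Type*} (s : Finset ι) (P : ι → PolySym n) (f : PolyDen n) :
    Nord n (∑ i ∈ s, P i) f = ∑ i ∈ s, Nord n (P i) f := by
  obtain ⟨G, h1, h2⟩ := Nord_lin f
  simp [h1]
theorem Nord_C_mul (a : ℝ) (P : PolySym n) (f : PolyDen n) :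
    Nord n (C a * P) f = C a * Nord n P f := by
  obtain ⟨G, h1, h2⟩ := Nord_lin f
  simp [h1, ← smul_eq_C_mul]
theorem Nord_add_right (P : PolySym n) (f g : PolyDen n) :
    Nord n P (f + g) = Nord n P f + Nord n P g := by
  simp only [Nord, derivMulti_add, mul_add, smul_add, Finset.sum_add_distrib]
theorem Nord_C_mul_right (a : ℝ) (P : PolySym n) (f : PolyDen n) :
    Nord n P (C a * f) = C a * Nord n P f := by
  simp only [Nord, ← smul_eq_C_mul, derivMulti_smul, mul_smul_comm, Finset.smul_sum]
  exact Finset.sum_congr rfl fun i _ => smul_comm _ _ _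
theorem Nord_zero_right (P : PolySym n) : Nord n P 0 = 0 := by
  have := Nord_C_mul_right 0 P 0
  simpa using this
theorem Nord_sum_right {ι : Type*} (s : Finset ι) (P : PolySym n) (f : ι → PolyDen n) :
    Nord n P (∑ i ∈ s, f i) = ∑ i ∈ s, Nord n P (f i) := by
  classical
  induction s using Finset.induction_on with
  | empty => simp [Nord_zero_right]
  | insert a s ha ih => rw [Finset.sum_insert ha, Finset.sum_insert ha, Nord_add_right, ih]

theorem xExp_add_inl (m : (Fin n ⊕ Fin n) →₀ ℕ) (i : Fin n) :
    xExp n (Finsupp.single (Sum.inl i) 1 + m) = Finsupp.single i 1 + xExp n m := by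
  ext j; simp [xExp, Finsupp.single_apply]
theorem xExp_add_inr (m : (Fin n ⊕ Fin n) →₀ ℕ) (i : Fin n) :
    xExp n (Finsupp.single (Sum.inr i) 1 + m) = xExp n m := by
  ext j; simp [xExp, Finsupp.single_apply]
theorem pExp_add_inl (m : (Fin n ⊕ Fin n) →₀ ℕ) (i : Fin n) :
    pExp n (Finsupp.single (Sum.inl i) 1 + m) = pExp n m := by
  ext j; simp [pExp, Finsupp.single_apply]
theorem pExp_add_inr (m : (Fin n ⊕ Fin n) →₀ ℕ) (i : Fin n) :
    pExp n (Finsupp.single (Sum.inr i) 1 + m) = pExp n m + Finsupp.single i 1 := by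
  ext j; simp [pExp, Finsupp.single_apply, add_comm]

theorem Nord_xv_mul (i : Fin n) (P : PolySym n) (f : PolyDen n) :
    Nord n (xv i * P) f = X i * Nord n P f := by
  obtain ⟨G, h1, h2⟩ := Nord_lin f
  have : G ∘ₗ LinearMap.mulLeft ℝ (xv i) = LinearMap.mulLeft ℝ (X i) ∘ₗ G := by
    apply (basisMonomials (Fin n ⊕ Fin n) ℝ).ext
    intro m
    simp only [coe_basisMonomials, LinearMap.comp_apply, LinearMap.mulLeft_apply, xv, X,
      monomial_mul, h2, xExp_add_inl, pExp_add_inl, one_mul, ← mul_assoc]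
  rw [h1, h1]
  exact congrArg (fun g => g P) this

theorem Nord_pv_mul (i : Fin n) (P : PolySym n) (f : PolyDen n) :
    Nord n (pv i * P) f = Nord n P (pderiv i f) := by
  obtain ⟨G, h1, h2⟩ := Nord_lin f
  obtain ⟨G', h1', h2'⟩ := Nord_lin (pderiv i f)
  have : G ∘ₗ LinearMap.mulLeft ℝ (pv i) = G' := by
    apply (basisMonomials (Fin n ⊕ Fin n) ℝ).ext
    intro m
    simp only [coe_basisMonomials, LinearMap.comp_apply, LinearMap.mulLeft_apply, pv, X,
      monomial_mul, h2, h2', xExp_add_inr, pExp_add_inr, one_mul, derivMulti_add_single]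
  rw [h1, h1', ← this]
  rfl

theorem Nord_C (a : ℝ) (f : PolyDen n) : Nord n (C a) f = C a * f := by
  have h : (C a : PolySym n) = C a * 1 := by simp
  rw [h, Nord_C_mul]
  congr 1
  obtain ⟨G, h1, h2⟩ := Nord_lin f
  rw [h1, show (1 : PolySym n) = monomial 0 1 from rfl, h2]
  rw [show xExp n 0 = 0 by ext; simp [xExp], show pExp n 0 = 0 by ext; simp [pExp], derivMulti_zero']
  simp

theorem sym_induction {p : PolySym n → Prop} (P : PolySym n) (hC : ∀ a, p (C a))
    (hadd : ∀ P Q, p P → p Q → p (P + Q)) (hx : ∀ i P, p P → p (xv i * P))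
    (hp : ∀ i P, p P → p (pv i * P)) : p P := by
  induction P using MvPolynomial.induction_on with
  | C a => exact hC a
  | add P Q h1 h2 => exact hadd P Q h1 h2
  | mul_X P i h =>
    rw [mul_comm]
    cases i with
    | inl i => exact hx i P h
    | inr i => exact hp i P h

theorem pderiv_Nord (i : Fin n) (P : PolySym n) : ∀ f : PolyDen n,
    pderiv i (Nord n P f) = Nord n (dx i P + pv i * P) f := by
  induction P using sym_induction with
  | hC a =>
    intro f
    simp only [dx, pderiv_C, zero_add, Nord_C, pderiv_C_mul, Nord_pv_mul]
  | hadd P Q h1 h2 =>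
    intro f
    rw [Nord_add, map_add, h1, h2, ← Nord_add]
    congr 1
    simp only [dx, map_add]; ring
  | hx j P h =>
    intro f
    rw [Nord_xv_mul, pderiv_mul, h, dx_mul, dx_xv, pderiv_X, Pi.single_apply,
      show (if i = j then (1 : PolySym n) else 0) * P + xv j * dx i P + pv i * (xv j * P)
        = (if i = j then (1 : PolySym n) else 0) * P + xv j * (dx i P + pv i * P) by ring,
      Nord_add (_ * P),
      Nord_xv_mul]
    congr 1
    by_cases hij : i = j
    · simp [hij]
    · simp [hij, Ne.symm hij, Nord]
  | hp j P h =>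
    intro f
    rw [Nord_pv_mul, h, dx_mul, dx_pv,
      show 0 * P + pv j * dx i P + pv i * (pv j * P) = pv j * (dx i P + pv i * P) by ring, Nord_pv_mul]

theorem Nord_X_mul (i : Fin n) (P : PolySym n) : ∀ f : PolyDen n,
    Nord n P (X i * f) = Nord n (xv i * P + dp i P) f := by
  induction P using sym_induction with
  | hC a =>
    intro f
    simp only [dp, pderiv_C, add_zero, Nord_xv_mul, Nord_C]
    ring
  | hadd P Q h1 h2 =>
    intro f
    rw [Nord_add, h1, h2, ← Nord_add]
    congr 1
    simp only [dp, map_add]; ring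
  | hx j P h =>
    intro f
    rw [Nord_xv_mul, h, dp_mul, dp_xv,
      show xv i * (xv j * P) + (0 * P + xv j * dp i P) = xv j * (xv i * P + dp i P) by ring,
      Nord_xv_mul]
  | hp j P h =>
    intro f
    rw [Nord_pv_mul, pderiv_mul, Nord_add_right, h, dp_mul, dp_pv, pderiv_X, Pi.single_apply,
      show xv i * (pv j * P) + ((if i = j then (1 : PolySym n) else 0) * P + pv j * dp i P)
        = (if i = j then (1 : PolySym n) else 0) * P + pv j * (xv i * P + dp i P) by ring,
      Nord_add ((if i = j then (1 : PolySym n) else 0) * P),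
      Nord_pv_mul]
    congr 1
    by_cases hij : i = j
    · simp [hij]
    · have h0 : Nord n (0 : PolySym n) f = 0 := by simp [Nord]
      simp [hij, Nord_zero_right, h0]

theorem coeff_Nord_one (P : PolySym n) (m : (Fin n ⊕ Fin n) →₀ ℕ) (hm : pExp n m = 0) :
    coeff (xExp n m) (Nord n P 1) = coeff m P := by
  obtain ⟨G, h1, h2⟩ := Nord_lin (1 : PolyDen n)
  have : lcoeff ℝ (xExp n m) ∘ₗ G = lcoeff ℝ m := by
    apply (basisMonomials (Fin n ⊕ Fin n) ℝ).ext
    intro m'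
    simp only [coe_basisMonomials, LinearMap.comp_apply, lcoeff_apply, h2, derivMulti_one,
      coeff_monomial]
    by_cases h : pExp n m' = 0
    · simp only [h, if_true, mul_one, coeff_monomial]
      congr 1
      apply propext
      constructor
      · intro hx
        ext j
        cases j with
        | inl j => exact DFunLike.congr_fun hx j
        | inr j => exact DFunLike.congr_fun (h.trans hm.symm) j
      · rintro rfl; rfl
    · rw [if_neg h, mul_zero, coeff_zero, if_neg]
      rintro rfl
      exact h hm
  rw [h1]
  exact congrArg (fun g => g P) this

theorem Nord_inj_aux (d : ℕ) : ∀ (P : PolySym n), (∀ f, Nord n P f = 0) →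
    ∀ m, (pExp n m).degree = d → coeff m P = 0 := by
  induction d with
  | zero =>
    intro P hP m hm
    rw [Finsupp.degree_eq_zero_iff] at hm
    rw [← coeff_Nord_one P m hm, hP, coeff_zero]
  | succ d ih =>
    intro P hP m hm
    have hne : pExp n m ≠ 0 := by
      intro h; rw [h] at hm; simp at hm
    obtain ⟨i, hi⟩ := Finsupp.ne_iff.mp hne
    have hi' : m (Sum.inr i) ≠ 0 := hi
    have hle : Finsupp.single (Sum.inr i) 1 ≤ m := by
      rw [Finsupp.single_le_iff]; omega
    obtain ⟨m', rfl⟩ := exists_add_of_le hle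
    rw [pExp_add_inr] at hm
    have hm' : (pExp n m').degree = d := by
      simpa [map_add] using hm
    have hd : ∀ f, Nord n (dp i P) f = 0 := by
      intro f
      have := Nord_X_mul i P f
      rw [hP, Nord_add, Nord_xv_mul, hP] at this
      simpa using this.symm
    have := ih _ hd m' hm'
    rw [dp, coeff_pderiv] at this
    rw [add_comm]
    have h2 : ((m' (Sum.inr i) : ℝ) + 1) ≠ 0 := by positivity
    simpa [h2] using this

theorem Nord_inj {P Q : PolySym n} (h : ∀ f, Nord n P f = Nord n Q f) : P = Q := by
  rw [← sub_eq_zero]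
  ext m
  rw [coeff_zero]
  exact Nord_inj_aux _ _ (fun f => by rw [Nord_sub, h, sub_self]) m rfl

end

/-! ### Intertwining of the normal ordering -/

section
variable {n : ℕ}

theorem ellOp_cVF (lam : ℝ) (b : Fin n) (f : PolyDen n) : ellOp n lam (cVF b) f = pderiv b f := by
  simp [ellOp_apply, Pi.single_apply, divVF, apply_ite]
theorem ellOp_lVF (lam : ℝ) (a b : Fin n) (f : PolyDen n) :
    ellOp n lam (lVF a b) f = X a * pderiv b f + C (if a = b then lam else 0) * f := by
  simp [ellOp_apply, Pi.single_apply, divVF, apply_ite, pderiv_X]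
  split_ifs <;> simp_all
theorem ellOp_projVF (lam : ℝ) (i : Fin n) (f : PolyDen n) :
    ellOp n lam (projVF n i) f = (∑ j, X i * (X j * pderiv j f)) + C (lam * (n + 1)) * (X i * f) := by
  have h1 : divVF n (projVF n i) = C ((n : ℝ) + 1) * X i := by
    simp [divVF, projVF, pderiv_X, Pi.single_apply, Finset.sum_add_distrib]
    ring
  rw [ellOp_apply, h1]
  simp only [projVF, map_mul, mul_assoc]

/-- The correction term in the action on symbols transported by normal ordering. -/
def Tcor (lam : ℝ) (i : Fin n) (P : PolySym n) : PolySym n :=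
  euP (dp i P) + C (lam * (n + 1)) * dp i P

theorem Nord_Lop_cVF (δ lam : ℝ) (b : Fin n) (P : PolySym n) (f : PolyDen n) :
    Nord n (Lop n δ (cVF b) P) f
      = ellOp n (lam + δ) (cVF b) (Nord n P f) - Nord n P (ellOp n lam (cVF b) f) := by
  rw [Lop_cVF, ellOp_cVF, ellOp_cVF, pderiv_Nord, Nord_add, Nord_pv_mul]
  ring

theorem Nord_Lop_lVF (δ lam : ℝ) (a b : Fin n) (P : PolySym n) (f : PolyDen n) :
    Nord n (Lop n δ (lVF a b) P) f
      = ellOp n (lam + δ) (lVF a b) (Nord n P f) - Nord n P (ellOp n lam (lVF a b) f) := by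
  have h : C δ * ((if a = b then 1 else 0) * P) = C (if a = b then δ else 0) * P := by
    split_ifs <;> simp
  rw [Lop_lVF, ellOp_lVF, ellOp_lVF, h]
  simp only [Nord_add, Nord_sub, Nord_xv_mul, Nord_pv_mul, Nord_C_mul, Nord_C_mul_right, Nord_add_right,
    Nord_X_mul, pderiv_Nord]
  split_ifs
  · simp only [map_add]; ring
  · simp only [map_zero]; ring

theorem Nord_Lop_projVF (δ lam : ℝ) (i : Fin n) (P : PolySym n) (f : PolyDen n) :
    Nord n (Lop n δ (projVF n i) P - Tcor lam i P) f
      = ellOp n (lam + δ) (projVF n i) (Nord n P f) - Nord n P (ellOp n lam (projVF n i) f) := by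
  rw [Lop_projVF, ellOp_projVF, ellOp_projVF, Tcor]
  simp only [euX, euP, pxS, Finset.sum_mul, mul_assoc, Nord_add, Nord_sub, Nord_sum, Nord_xv_mul,
    Nord_pv_mul, Nord_C_mul, Nord_C_mul_right, Nord_add_right, Nord_sum_right, Nord_X_mul, pderiv_Nord,
    mul_add, add_mul, Finset.sum_add_distrib, ← Finset.mul_sum, map_add, dp_mul, dp_xv, zero_mul,
    zero_add]
  have h : ∑ x, X x * (X i * Nord n P (pderiv x f)) = X i * ∑ x, X x * Nord n P (pderiv x f) := by
    rw [Finset.mul_sum]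
    exact Finset.sum_congr rfl fun j _ => by ring
  rw [h]
  ring

/-! ### Affine fields -/

theorem affine_induction {p : PolyVF n → Prop} (hadd : ∀ X Y, p X → p Y → p (X + Y))
    (hsmul : ∀ (a : ℝ) X, p X → p (a • X)) (h0 : p 0) (hc : ∀ b, p (cVF b)) (hl : ∀ a b, p (lVF a b))
    (Xf : PolyVF n) (hX : ∀ i, (Xf i).totalDegree ≤ 1) : p Xf := by
  have hsum : ∀ {ι : Type} (s : Finset ι) (F : ι → PolyVF n), (∀ i ∈ s, p (F i)) → p (∑ i ∈ s, F i) := by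
    intro ι s F hF
    exact Finset.sum_induction F p hadd h0 hF
  rw [← Finset.univ_sum_single Xf]
  apply hsum
  intro b _
  have : (Pi.single b (Xf b) : PolyVF n)
      = ∑ m ∈ (Xf b).support, (Xf b).coeff m • Pi.single b (monomial m (1 : ℝ)) := by
    conv_lhs => rw [(Xf b).as_sum]
    ext1 j
    by_cases h : j = b
    · subst h; simp [Finset.sum_apply, smul_monomial]
    · simp [Finset.sum_apply, h]
  rw [this]
  apply hsum
  intro m hm
  apply hsmul
  have hd : m.degree ≤ 1 := (le_totalDegree hm).trans (hX b)
  rcases Nat.le_one_iff_eq_zero_or_eq_one.mp hd with h | h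
  · rw [Finsupp.degree_eq_zero_iff] at h
    subst h
    exact hc b
  · have hne : m ≠ 0 := by rintro rfl; simp at h
    obtain ⟨a, ha⟩ := Finsupp.ne_iff.mp hne
    have hle : Finsupp.single a 1 ≤ m := by
      rw [Finsupp.single_le_iff]
      exact Nat.one_le_iff_ne_zero.mpr ha
    obtain ⟨m', rfl⟩ := exists_add_of_le hle
    have hm' : m'.degree = 0 := by simpa [map_add] using h
    rw [Finsupp.degree_eq_zero_iff] at hm'
    subst hm'
    rw [add_zero]
    exact hl a b

theorem affine_props (δ lam : ℝ) (Xf : PolyVF n) (hX : ∀ i, (Xf i).totalDegree ≤ 1) :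
    (∀ P, divF (Lop n δ Xf P) = Lop n δ Xf (divF P)) ∧
    ∀ P f, Nord n (Lop n δ Xf P) f
      = ellOp n (lam + δ) Xf (Nord n P f) - Nord n P (ellOp n lam Xf f) := by
  have hsm : ∀ (a : ℝ) (X : PolyVF n),
     ((∀ P, divF (Lop n δ X P) = Lop n δ X (divF P)) ∧ ∀ P f, Nord n (Lop n δ X P) f
      = ellOp n (lam + δ) X (Nord n P f) - Nord n P (ellOp n lam X f)) →
     ((∀ P, divF (Lop n δ (a • X) P) = Lop n δ (a • X) (divF P)) ∧
       ∀ P f, Nord n (Lop n δ (a • X) P) f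
      = ellOp n (lam + δ) (a • X) (Nord n P f) - Nord n P (ellOp n lam (a • X) f)) := by
    rintro a X ⟨h1, h2⟩
    constructor
    · intro P; rw [Lop_smul, Lop_smul, divF_C_mul, h1]
    · intro P f
      rw [Lop_smul, ellOp_smul, ellOp_smul, Nord_C_mul, Nord_C_mul_right, h2]; ring
  refine affine_induction (p := fun Xf => (∀ P, divF (Lop n δ Xf P) = Lop n δ Xf (divF P)) ∧
    ∀ P f, Nord n (Lop n δ Xf P) f
      = ellOp n (lam + δ) Xf (Nord n P f) - Nord n P (ellOp n lam Xf f)) ?_ hsm ?_ ?_ ?_ Xf hX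
  · rintro X Y ⟨h1, h2⟩ ⟨h3, h4⟩
    constructor
    · intro P; rw [Lop_add, Lop_add, divF_add, h1, h3]
    · intro P f
      rw [Lop_add, ellOp_add, ellOp_add, Nord_add, Nord_add_right, h2, h4]; ring
  · constructor
    · intro P
      have h : ∀ Q : PolySym n, Lop n δ 0 Q = 0 := by
        intro Q
        have := Lop_smul δ 0 (0 : PolyVF n) Q
        simpa using this
      rw [h, h]; simp [divF]
    · intro P f
      have h : Nord n (0 : PolySym n) f = 0 := by simp [Nord]
      simp [Lop_apply, ellOp_apply, divVF, liftX, Nord_zero_right, h]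
  · exact fun b => ⟨divF_Lop_cVF δ b, Nord_Lop_cVF δ lam b⟩
  · exact fun a b => ⟨divF_Lop_lVF δ a b, Nord_Lop_lVF δ lam a b⟩

theorem cVF_mem (b : Fin n) : cVF b ∈ projGenSet n := by
  left
  intro i
  by_cases h : i = b
  · subst h; simp
  · simp [h]
theorem lVF_mem (a b : Fin n) : lVF a b ∈ projGenSet n := by
  left
  intro i
  by_cases h : i = b
  · subst h; simp [totalDegree_X]
  · simp [h]

theorem lVF_affine (a b : Fin n) (i : Fin n) : (lVF a b i).totalDegree ≤ 1 := by
  by_cases h : i = b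
  · subst h; simp [totalDegree_X]
  · simp [h]
theorem cVF_affine (b : Fin n) (i : Fin n) : (cVF b i).totalDegree ≤ 1 := by
  by_cases h : i = b
  · subst h; simp
  · simp [h]

/-! ### Degree in the fibre variables -/

def pd (m : (Fin n ⊕ Fin n) →₀ ℕ) : ℕ := ∑ j, m (Sum.inr j)

theorem weight_pwt (m : (Fin n ⊕ Fin n) →₀ ℕ) : Finsupp.weight (pwt n) m = pd m := by
  rw [Finsupp.weight_apply, Finsupp.sum_fintype _ _ (by simp)]
  simp [pwt, pd]

theorem coeff_euP (P : PolySym n) (m : (Fin n ⊕ Fin n) →₀ ℕ) :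
    coeff m (euP P) = pd m * coeff m P := by
  induction P using MvPolynomial.induction_on' with
  | monomial u a =>
    simp only [euP, pv, dp, X_mul_pderiv_monomial, coeff_smul, ← Finset.sum_smul]
    by_cases h : u = m
    · subst h; simp [pd]
    · simp [coeff_monomial, h]
  | add P Q h1 h2 => rw [euP_add, coeff_add, h1, h2, coeff_add]; ring

theorem isPHomog_iff (P : PolySym n) (k : ℕ) : IsPHomog n P k ↔ euP P = C (k : ℝ) * P := by
  constructor
  · intro h
    ext m
    rw [coeff_euP, coeff_C_mul]
    by_cases hm : coeff m P = 0
    · simp [hm]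
    · rw [← h hm, weight_pwt]
  · intro h m hm
    have := congrArg (coeff m) h
    rw [coeff_euP, coeff_C_mul] at this
    have := mul_right_cancel₀ hm this
    rw [weight_pwt]
    exact_mod_cast this

theorem eigen_coeff {P : PolySym n} {r : ℝ} (h : euP P = C r * P) (m : (Fin n ⊕ Fin n) →₀ ℕ)
    (hm : r ≠ pd m) : coeff m P = 0 := by
  have := congrArg (coeff m) h
  rw [coeff_euP, coeff_C_mul] at this
  by_contra h0
  exact hm (mul_right_cancel₀ h0 this).symm

theorem eigen_dp {P : PolySym n} {r : ℝ} (h : euP P = C r * P) (i : Fin n) :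
    euP (dp i P) = C (r - 1) * dp i P := by
  have := congrArg (dp i) h
  rw [dp_euP, show dp i (C r * P) = C r * dp i P from pderiv_C_mul] at this
  rw [map_sub, map_one, sub_mul, ← this]; ring

theorem eigen_divF {P : PolySym n} {r : ℝ} (h : euP P = C r * P) :
    euP (divF P) = C (r - 1) * divF P := by
  have := congrArg divF h
  rw [divF_euP, divF_C_mul] at this
  rw [map_sub, map_one, sub_mul, ← this]; ring

theorem eigen_divPow {P : PolySym n} {r : ℝ} (h : euP P = C r * P) (m : ℕ) :
    euP ((divOp n ^ m) P) = C (r - m) * (divOp n ^ m) P := by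
  induction m with
  | zero => simpa using h
  | succ m ih =>
    rw [pow_succ', Module.End.mul_apply, divOp_apply, eigen_divF ih]
    push_cast
    congr 2
    ring

theorem divPow_Lop_projVF (δ : ℝ) (i : Fin n) {P : PolySym n} {k : ℝ} (h : euP P = C k * P) (m : ℕ) :
    (divOp n ^ (m + 1)) (Lop n δ (projVF n i) P) = Lop n δ (projVF n i) ((divOp n ^ (m + 1)) P)
      + C (((m : ℝ) + 1) * (-2 * k + ((m : ℝ) + 1) + 1 + (δ - 1) * (n + 1))) *
        dp i ((divOp n ^ m) P) := by
  induction m with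
  | zero =>
    simp only [zero_add, pow_one, pow_zero, Module.End.one_apply, divOp_apply]
    rw [divF_Lop_projVF, eigen_dp h]
    congr 1
    rw [show (2 : PolySym n) = C 2 from rfl, ← mul_assoc, ← map_mul, ← sub_mul, ← map_sub]
    congr 2
    push_cast
    ring
  | succ m ih =>
    have e := eigen_dp (eigen_divPow h (m + 1)) i
    rw [pow_succ', Module.End.mul_apply, ih, map_add, divOp_apply, divOp_apply, divF_Lop_projVF,
      divF_C_mul, ← dp_divF, e, add_assoc, Module.End.mul_apply, divOp_apply]
    congr 1
    rw [show divF ((divOp n ^ m) P) = (divOp n ^ (m + 1)) P by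
      rw [pow_succ', Module.End.mul_apply, divOp_apply]]
    rw [show (2 : PolySym n) = C 2 from rfl, ← mul_assoc, ← map_mul, ← sub_mul, ← map_sub, ← add_mul,
      ← map_add]
    congr 2
    push_cast
    ring

end

/-! ### Casimir operator -/

section
variable {n : ℕ}

theorem euX_sub (P Q : PolySym n) : euX (P - Q) = euX P - euX Q := by
  simp [euX, mul_sub, Finset.sum_sub_distrib]
theorem euP_sub (P Q : PolySym n) : euP (P - Q) = euP P - euP Q := by
  simp [euP, mul_sub, Finset.sum_sub_distrib]
theorem euX_C_mul (a : ℝ) (P : PolySym n) : euX (C a * P) = C a * euX P := by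
  simp only [euX, dx, pderiv_C_mul, Finset.mul_sum]
  exact Finset.sum_congr rfl fun i _ => by ring

theorem sum_euX_dx (P : PolySym n) : ∑ a, xv a * euX (dx a P) = euX (euX P) - euX P := by
  have h : ∀ a : Fin n, xv a * euX (dx a P) = xv a * dx a (euX P) - xv a * dx a P := by
    intro a; rw [dx_euX]; ring
  simp only [h, Finset.sum_sub_distrib]
  rfl
theorem sum_euP_dp (P : PolySym n) : ∑ a, pv a * euP (dp a P) = euP (euP P) - euP P := by
  have h : ∀ a : Fin n, pv a * euP (dp a P) = pv a * dp a (euP P) - pv a * dp a P := by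
    intro a; rw [dp_euP]; ring
  simp only [h, Finset.sum_sub_distrib]
  rfl
theorem sum_euP_dx (P : PolySym n) : ∑ a, xv a * euP (dx a P) = euX (euP P) := by
  simp only [← dx_euP]
  rfl
theorem euP_euX (P : PolySym n) : euP (euX P) = euX (euP P) := by
  rw [← sum_euP_dx]
  simp only [euP, dp_euX]
  simp only [euX, Finset.mul_sum]
  rw [Finset.sum_comm]
  refine Finset.sum_congr rfl fun i _ => Finset.sum_congr rfl fun j _ => ?_
  rw [show dp j (dx i P) = dx i (dp j P) from pderiv_comm' _ _ _]
  ring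
theorem sum_dp_dx (P : PolySym n) : ∑ i, dp i (dx i P) = divF P :=
  Finset.sum_congr rfl fun i _ => pderiv_comm' _ _ _

def casK (δ : ℝ) (P : PolySym n) : PolySym n := ∑ i, Lop n δ (projVF n i) (dx i P)
def casW (δ : ℝ) (P : PolySym n) : PolySym n :=
  ∑ a, ∑ b, Lop n δ (lVF a b) (Lop n δ (lVF b a) P)
def casZ (δ : ℝ) (P : PolySym n) : PolySym n := ∑ a, Lop n δ (lVF a a) P

theorem casK_eq (δ : ℝ) (P : PolySym n) : casK δ P =
    euX (euX P) - euX P - pxS n * divF P - euX (euP P) + C (δ * (n + 1)) * euX P := by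
  simp only [casK, Lop_projVF, Finset.sum_add_distrib, Finset.sum_sub_distrib, ← Finset.mul_sum,
    sum_euX_dx, sum_euP_dx, sum_dp_dx]
  rfl

theorem casZ_eq (δ : ℝ) (P : PolySym n) : casZ δ P = euX P - euP P + C (n * δ) * P := by
  simp only [casZ, Lop_lVF, Finset.sum_add_distrib, Finset.sum_sub_distrib, if_true, one_mul]
  simp [euX, euP]
  ring

def Aop (a b : Fin n) (P : PolySym n) : PolySym n := xv a * dx b P - pv b * dp a P

theorem sum_Aop (P : PolySym n) : ∑ a, ∑ b, Aop a b (Aop b a P) =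
    (n : PolySym n) * euX P + (euX (euX P) - euX P) - 2 * (pxS n * divF P)
      + (n : PolySym n) * euP P + (euP (euP P) - euP P) := by
  have h : ∀ a b : Fin n, Aop a b (Aop b a P) = xv a * dx a P + xv a * (xv b * dx b (dx a P))
      - pv a * xv a * dx b (dp b P) - pv b * xv b * dp a (dx a P) + pv b * dp b P
      + pv b * (pv a * dp a (dp b P)) := by
    intro a b
    simp only [Aop, dx, dp, map_sub, pderiv_mul]
    rw [show pderiv (Sum.inl b) (xv b) = 1 from pderiv_X_self _,
      show pderiv (Sum.inr a) (pv a) = 1 from pderiv_X_self _,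
      show pderiv (Sum.inl b) (pv a) = 0 from dx_pv _ _,
      show pderiv (Sum.inr a) (xv b) = 0 from dp_xv _ _]
    ring
  simp only [h, Finset.sum_add_distrib, Finset.sum_sub_distrib]
  rw [← sum_euX_dx, ← sum_euP_dp]
  have h1 : ∑ a : Fin n, ∑ _b : Fin n, xv a * dx a P = (n : PolySym n) * euX P := by
    simp [euX, Finset.mul_sum]
  have h2 : ∑ _a : Fin n, ∑ b : Fin n, pv b * dp b P = (n : PolySym n) * euP P := by
    simp [euP]
  have h3 : ∑ a : Fin n, ∑ b : Fin n, xv a * (xv b * dx b (dx a P)) = ∑ a, xv a * euX (dx a P) := by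
    simp only [euX, Finset.mul_sum]
  have h4 : ∑ a : Fin n, ∑ b : Fin n, pv b * (pv a * dp a (dp b P)) = ∑ a, pv a * euP (dp a P) := by
    rw [Finset.sum_comm]
    simp only [euP, Finset.mul_sum]
  have h5 : ∑ a : Fin n, ∑ b : Fin n, pv a * xv a * dx b (dp b P) = pxS n * divF P := by
    simp only [← Finset.mul_sum, ← Finset.sum_mul]
    rfl
  have h6 : ∑ a : Fin n, ∑ b : Fin n, pv b * xv b * dp a (dx a P) = pxS n * divF P := by
    rw [← sum_dp_dx, Finset.sum_comm]
    simp only [← Finset.mul_sum, ← Finset.sum_mul]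
    rfl
  rw [h1, h2, h3, h4, h5, h6]
  ring

theorem casW_eq (δ : ℝ) (P : PolySym n) : casW δ P =
    (n : PolySym n) * euX P + (euX (euX P) - euX P) - 2 * (pxS n * divF P)
      + (n : PolySym n) * euP P + (euP (euP P) - euP P)
      + 2 * C δ * (euX P - euP P) + (n : PolySym n) * (C δ * C δ) * P := by
  have h : ∀ a b : Fin n, Lop n δ (lVF a b) (Lop n δ (lVF b a) P) = Aop a b (Aop b a P)
      + if a = b then (2 * C δ * (xv a * dx a P - pv a * dp a P) + C δ * C δ * P) else 0 := by
    intro a b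
    rw [Lop_lVF, Lop_lVF]
    by_cases hab : a = b
    · subst hab
      simp only [if_true, one_mul, Aop, dx, dp, map_add, pderiv_C_mul]
      ring
    · simp [hab, Ne.symm hab, Aop]
  simp only [casW, h, Finset.sum_add_distrib, sum_Aop]
  simp only [Finset.sum_ite_eq, Finset.mem_univ, if_true, Finset.sum_add_distrib,
    ← Finset.mul_sum, Finset.sum_sub_distrib]
  simp [euX, euP]
  ring

theorem casimir (δ : ℝ) (P : PolySym n) :
    2 * casK δ P - casW δ P - casZ δ (casZ δ P) + C ((n : ℝ) + 1) * casZ δ P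
      = -2 * euP (euP P) + C (2 * δ * (n + 1) - 2 * n) * euP P
        + C (-n * δ ^ 2 - n ^ 2 * δ ^ 2 + (n + 1) * n * δ) * P := by
  rw [casK_eq, casW_eq, casZ_eq δ P, casZ_eq]
  simp only [euX_add, euX_sub, euX_C_mul, euP_add, euP_sub, euP_C_mul, euP_euX]
  simp only [map_add, map_sub,
    map_mul, map_neg, map_pow, map_natCast, map_one, map_ofNat]
  ring

theorem eigen_Lop_lVF {δ : ℝ} {P : PolySym n} {r : ℝ} (h : euP P = C r * P) (a b : Fin n) :
    euP (Lop n δ (lVF a b) P) = C r * Lop n δ (lVF a b) P := by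
  have hx : ∀ Q : PolySym n, euP (xv a * Q) = xv a * euP Q := by
    intro Q
    simp only [euP, dp_mul, dp_xv, Finset.mul_sum]
    exact Finset.sum_congr rfl fun i _ => by ring
  have hp : ∀ Q : PolySym n, euP (pv b * Q) = pv b * euP Q + pv b * Q := by
    intro Q
    simp only [euP, dp_mul, dp_pv, mul_add, Finset.sum_add_distrib, Finset.mul_sum]
    rw [add_comm]
    congr 1
    · exact Finset.sum_congr rfl fun i _ => by ring
    · simp
  have hd : euP (dx b P) = C r * dx b P := by
    rw [← dx_euP, h]; exact pderiv_C_mul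
  rw [Lop_lVF, euP_add, euP_sub, hx, hp, hd, eigen_dp h, euP_C_mul,
    show euP ((if a = b then 1 else 0) * P) = (if a = b then 1 else 0) * euP P by
      split_ifs <;> simp [euP], h, map_sub, map_one]
  ring

theorem eigen_dx {P : PolySym n} {r : ℝ} (h : euP P = C r * P) (b : Fin n) :
    euP (dx b P) = C r * dx b P := by
  rw [← dx_euP, h]; exact pderiv_C_mul

theorem sum_Tcor (lam : ℝ) (P : PolySym n) :
    ∑ i, Tcor lam i (dx i P) = euP (divF P) + C (lam * (n + 1)) * divF P := by
  simp only [Tcor, Finset.sum_add_distrib, ← Finset.mul_sum, sum_dp_dx]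
  congr 1
  rw [← sum_dp_dx]
  simp only [euP, map_sum, Finset.mul_sum]
  rw [Finset.sum_comm]

/-- Casimir relation for an equivariant map. -/
theorem casimir_rel (δ lam : ℝ) (k : ℕ) (Ψ : Module.End ℝ (PolySym n))
    (hc : ∀ b P, IsPHomog n P k → Ψ (Lop n δ (cVF b) P) = Lop n δ (cVF b) (Ψ P))
    (hl : ∀ a b P, IsPHomog n P k → Ψ (Lop n δ (lVF a b) P) = Lop n δ (lVF a b) (Ψ P))
    (hp : ∀ i P, IsPHomog n P k →
      Ψ (Lop n δ (projVF n i) P) = Lop n δ (projVF n i) (Ψ P) - Tcor lam i (Ψ P))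
    (P : PolySym n) (hP : IsPHomog n P k) :
    C (-2 * (k : ℝ) ^ 2 + (2 * δ * (n + 1) - 2 * n) * k) * Ψ P
      = -2 * euP (euP (Ψ P)) + C (2 * δ * (n + 1) - 2 * n) * euP (Ψ P)
        - 2 * (euP (divF (Ψ P)) + C (lam * (n + 1)) * divF (Ψ P)) := by
  have hE : euP P = C (k : ℝ) * P := (isPHomog_iff P k).mp hP
  have hdx : ∀ i, IsPHomog n (dx i P) k := fun i => (isPHomog_iff _ k).mpr (eigen_dx hE i)
  have hlP : ∀ a b, IsPHomog n (Lop n δ (lVF a b) P) k := fun a b =>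
    (isPHomog_iff _ k).mpr (eigen_Lop_lVF hE a b)
  have hΨdx : ∀ i, Ψ (dx i P) = dx i (Ψ P) := by
    intro i
    have := hc i P hP
    rwa [Lop_cVF, Lop_cVF] at this
  have hK : Ψ (casK δ P) = casK δ (Ψ P) - (euP (divF (Ψ P)) + C (lam * (n + 1)) * divF (Ψ P)) := by
    simp only [casK, map_sum, hp _ _ (hdx _), hΨdx, Finset.sum_sub_distrib, sum_Tcor]
  have hW : Ψ (casW δ P) = casW δ (Ψ P) := by
    simp only [casW, map_sum, hl _ _ _ (hlP _ _), hl _ _ _ hP]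
  have hZ : ∀ Q, IsPHomog n Q k → Ψ (casZ δ Q) = casZ δ (Ψ Q) := by
    intro Q hQ
    simp only [casZ, map_sum, hl _ _ _ hQ]
  have hZP : IsPHomog n (casZ δ P) k :=
    IsWeightedHomogeneous.sum _ _ _ fun a _ => hlP a a
  have hCm : ∀ (a : ℝ) Q, Ψ (C a * Q) = C a * Ψ Q := by
    intro a Q
    rw [← smul_eq_C_mul, map_smul, smul_eq_C_mul]
  have h2 : (2 : PolySym n) = C 2 := rfl
  have e1 := casimir δ P
  have e2 := casimir δ (Ψ P)
  have e3 := congrArg Ψ e1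
  rw [neg_mul, h2, map_add, map_sub, map_sub, hCm, hCm, hK, hW, hZ _ hZP, hZ _ hP] at e3
  rw [hE, euP_C_mul, hE] at e3
  rw [Ψ.map_add, Ψ.map_add, Ψ.map_neg, hCm, hCm, hCm, hCm, hCm, hCm] at e3
  rw [h2] at e2 ⊢
  simp only [map_add, map_sub, map_mul, map_neg, map_pow, map_natCast, map_one, map_ofNat] at e2 e3 ⊢
  linear_combination -e3 + e2

theorem coeff_divF_eq_zero (R : PolySym n) (t : (Fin n ⊕ Fin n) →₀ ℕ)
    (h : ∀ s, pd s = pd t + 1 → coeff s R = 0) : coeff t (divF R) = 0 := by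
  rw [divF, coeff_sum]
  refine Finset.sum_eq_zero fun j _ => ?_
  rw [dx, coeff_pderiv, dp, coeff_pderiv, h, zero_mul, zero_mul]
  simp [pd, Finset.sum_add_distrib, Finsupp.single_apply]

theorem uniq_zero (δ lam : ℝ) (k : ℕ)
    (hd : ∀ m : ℕ, 1 ≤ m → m ≤ k → -2 * (k : ℝ) + m + 1 + (δ - 1) * (n + 1) ≠ 0) (R : PolySym n)
    (hk : ∀ t, k ≤ pd t → coeff t R = 0)
    (hR : C (-2 * (k : ℝ) ^ 2 + (2 * δ * (n + 1) - 2 * n) * k) * R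
      = -2 * euP (euP R) + C (2 * δ * (n + 1) - 2 * n) * euP R
        - 2 * (euP (divF R) + C (lam * (n + 1)) * divF R)) : R = 0 := by
  have key : ∀ m : ℕ, ∀ t, pd t + m = k → coeff t R = 0 := by
    intro m
    induction m with
    | zero => exact fun t ht => hk t (by omega)
    | succ m ih =>
      intro t ht
      have h0 : coeff t (divF R) = 0 := coeff_divF_eq_zero R t fun s hs => ih s (by omega)
      have e := congrArg (coeff t) hR
      rw [show (-2 : PolySym n) = C (-2) by rw [map_neg]; rfl, show (2 : PolySym n) = C 2 from rfl] at e
      simp only [coeff_sub, coeff_add, coeff_C_mul, coeff_euP, h0] at e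
      have hkk : (k : ℝ) = pd t + (m + 1) := by exact_mod_cast ht.symm
      have hne := hd (m + 1) (by omega) (by omega)
      have : ((m : ℝ) + 1) * ((-2 * (k : ℝ) + ((m + 1 : ℕ) : ℝ) + 1 + (δ - 1) * (n + 1))
          * coeff t R) = 0 := by
        have hpt : (pd t : ℝ) = k - (m + 1) := by linarith
        rw [hpt] at e
        push_cast
        linear_combination e / 2
      have hm : ((m : ℝ) + 1) ≠ 0 := by positivity
      exact (mul_eq_zero.mp ((mul_eq_zero.mp this).resolve_left hm)).resolve_left hne
  ext t
  rw [coeff_zero]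
  rcases le_total k (pd t) with h | h
  · exact hk t h
  · exact key (k - pd t) t (by omega)

end

/-! ### Reformulation of equivariance and existence -/

theorem Tcor_sub {n : ℕ} (lam : ℝ) (i : Fin n) (P Q : PolySym n) :
    Tcor lam i (P - Q) = Tcor lam i P - Tcor lam i Q := by
  simp only [Tcor, dp, map_sub, euP_sub]
  ring

theorem comp_zero_iff (n k : ℕ) (R : PolySym n) :
    (∀ d, k ≤ d → weightedHomogeneousComponent (pwt n) d R = 0) ↔ ∀ t, k ≤ pd t → coeff t R = 0 := by
  constructor
  · intro h t ht
    have := congrArg (coeff t) (h _ ht)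
    rw [coeff_weightedHomogeneousComponent, weight_pwt, if_pos rfl, coeff_zero] at this
    exact this
  · intro h d hd
    ext t
    rw [coeff_weightedHomogeneousComponent, weight_pwt, coeff_zero]
    split_ifs with h1
    · exact h t (h1 ▸ hd)
    · rfl

theorem isProjEquivQuant_iff' (n k : ℕ) (δ lam : ℝ) (Φ : Module.End ℝ (PolySym n)) :
    IsProjEquivQuant n k δ lam Φ ↔
      (∀ P : PolySym n, IsPHomog n P k → ∀ t, k ≤ pd t → coeff t (Φ P - P) = 0) ∧
      (∀ Xf : PolyVF n, (∀ i, (Xf i).totalDegree ≤ 1) → ∀ P, IsPHomog n P k →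
        Φ (Lop n δ Xf P) = Lop n δ Xf (Φ P)) ∧
      (∀ i P, IsPHomog n P k →
        Φ (Lop n δ (projVF n i) P) = Lop n δ (projVF n i) (Φ P) - Tcor lam i (Φ P)) := by
  constructor
  · rintro ⟨h1, h2⟩
    refine ⟨fun P hP => (comp_zero_iff n k _).mp (h1 P hP), fun Xf hX P hP => ?_, fun i P hP => ?_⟩
    · apply Nord_inj
      intro f
      rw [h2 Xf (Or.inl hX) P hP f, (affine_props δ lam Xf hX).2]
    · apply Nord_inj
      intro f
      rw [h2 _ (Or.inr ⟨i, rfl⟩) P hP f, Nord_Lop_projVF]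
  · rintro ⟨h1, h2, h3⟩
    refine ⟨fun P hP => (comp_zero_iff n k _).mpr (h1 P hP), ?_⟩
    rintro Xf (hX | ⟨i, rfl⟩) P hP f
    · rw [h2 Xf hX P hP, (affine_props δ lam Xf hX).2]
    · rw [h3 i P hP, Nord_Lop_projVF]

theorem Q_isProjEquivQuant (n k : ℕ) (δ lam : ℝ)
    (hd : ∀ m : ℕ, 1 ≤ m → m ≤ k → -2 * (k : ℝ) + m + 1 + (δ - 1) * (n + 1) ≠ 0)
    (c : ℕ → ℝ) (hc0 : c 0 = 1)
    (hc : ∀ m : ℕ, 1 ≤ m → m ≤ k →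
      c m = (-(((k : ℝ) - (m : ℝ)) + lam * ((n : ℝ) + 1))
          / ((m : ℝ) * (-2 * (k : ℝ) + (m : ℝ) + 1 + (δ - 1) * ((n : ℝ) + 1)))) * c (m - 1)) :
    IsProjEquivQuant n k δ lam (∑ m ∈ Finset.range (k + 1), c m • divOp n ^ m) := by
  have hQ : ∀ P, (∑ m ∈ Finset.range (k + 1), c m • divOp n ^ m) P
      = ∑ m ∈ Finset.range (k + 1), C (c m) * (divOp n ^ m) P := by
    intro P
    simp [LinearMap.sum_apply, smul_eq_C_mul]
  rw [isProjEquivQuant_iff']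
  refine ⟨fun P hP t ht => ?_, fun Xf hX P hP => ?_, fun i P hP => ?_⟩
  · have hE := (isPHomog_iff P k).mp hP
    rw [hQ, Finset.sum_range_succ', hc0]
    simp only [pow_zero, Module.End.one_apply, map_one, one_mul, add_sub_cancel_right, coeff_sum,
      coeff_C_mul]
    refine Finset.sum_eq_zero fun m _ => ?_
    rw [eigen_coeff (eigen_divPow hE (m + 1)) t, mul_zero]
    have h1 : (k : ℝ) ≤ pd t := by exact_mod_cast ht
    push_cast
    have : (0 : ℝ) ≤ m := Nat.cast_nonneg m
    intro h
    linarith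
  · have hD : ∀ m : ℕ, (divOp n ^ m) (Lop n δ Xf P) = Lop n δ Xf ((divOp n ^ m) P) := by
      intro m
      induction m with
      | zero => rfl
      | succ m ih =>
        rw [pow_succ', Module.End.mul_apply, Module.End.mul_apply, ih, divOp_apply, divOp_apply,
          (affine_props δ lam Xf hX).1]
    rw [hQ, hQ, map_sum]
    refine Finset.sum_congr rfl fun m _ => ?_
    rw [hD, ← smul_eq_C_mul, ← smul_eq_C_mul, map_smul]
  · have hE := (isPHomog_iff P k).mp hP
    have hT : ∀ m : ℕ, Tcor lam i (C (c m) * (divOp n ^ m) P)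
        = C (c m * (((k : ℝ) - m - 1) + lam * (n + 1))) * dp i ((divOp n ^ m) P) := by
      intro m
      rw [Tcor, show dp i (C (c m) * (divOp n ^ m) P) = C (c m) * dp i ((divOp n ^ m) P)
        from pderiv_C_mul, euP_C_mul, eigen_dp (eigen_divPow hE m) i]
      simp only [map_mul, map_add]
      ring
    have hTsum : ∀ s : Finset ℕ, Tcor lam i (∑ m ∈ s, C (c m) * (divOp n ^ m) P)
        = ∑ m ∈ s, Tcor lam i (C (c m) * (divOp n ^ m) P) := by
      intro s
      let T : PolySym n →+ PolySym n := AddMonoidHom.ofMapSub (Tcor lam i) (Tcor_sub lam i)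
      exact map_sum T _ s
    have hLC : ∀ (a : ℝ) R, Lop n δ (projVF n i) (C a * R) = C a * Lop n δ (projVF n i) R := by
      intro a R
      rw [← smul_eq_C_mul, map_smul, smul_eq_C_mul]
    have htop : dp i ((divOp n ^ k) P) = 0 := by
      ext t
      rw [coeff_zero]
      apply eigen_coeff (eigen_dp (eigen_divPow hE k) i)
      have : (0 : ℝ) ≤ pd t := Nat.cast_nonneg _
      intro h
      linarith
    rw [hQ, hQ, hTsum, map_sum]
    simp only [hT, hLC]
    rw [Finset.sum_range_succ', Finset.sum_range_succ' (fun m => C (c m) * Lop n δ (projVF n i) _),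
      Finset.sum_range_succ (fun m => _ * dp i ((divOp n ^ m) P)), htop, mul_zero, add_zero]
    simp only [divPow_Lop_projVF δ i hE, mul_add, Finset.sum_add_distrib]
    have hkey : ∑ m ∈ Finset.range k, C (c (m + 1)) *
        (C (((m : ℝ) + 1) * (-2 * (k : ℝ) + ((m : ℝ) + 1) + 1 + (δ - 1) * (n + 1))) *
          dp i ((divOp n ^ m) P))
        = - ∑ m ∈ Finset.range k,
          C (c m * (((k : ℝ) - m - 1) + lam * (n + 1))) * dp i ((divOp n ^ m) P) := by
      rw [← Finset.sum_neg_distrib]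
      refine Finset.sum_congr rfl fun m hm => ?_
      have hmk : m + 1 ≤ k := by
        have := Finset.mem_range.mp hm
        omega
      have h1 := hc (m + 1) (by omega) hmk
      have h2 := hd (m + 1) (by omega) hmk
      rw [← mul_assoc, ← map_mul, ← neg_mul, ← map_neg]
      congr 2
      rw [h1, Nat.add_sub_cancel]
      push_cast at h2 ⊢
      have h3 : ((m : ℝ) + 1) ≠ 0 := by positivity
      have h4 := mul_ne_zero h3 h2
      rw [div_mul_eq_mul_div, div_mul_cancel₀ _ h4]
      ring
    simp only [mul_add] at hkey
    rw [hkey]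
    simp only [pow_zero, Module.End.one_apply]
    ring

/-- If `δ` avoids the critical values `1 + (2k-l-1)/(n+1)`, `1 ≤ l ≤ k`, and
the coefficients are given by `c_0 = 1`, `c_m = (ℓ_{k-m}(λ)/d^k_m(δ)) c_{m-1}` with
`ℓ_j(λ) = -(j + λ(n+1))` and `d^k_m(δ) = m(-2k+m+1+(δ-1)(n+1))`, then
`Q = Σ_{m=0}^{k} c_m D^m` (composed with normal ordering) is the unique projectively
equivariant quantization on symbols of degree `k`. -/
theorem projectively_equivariant_quantization_explicit (n k : ℕ) (hn : 1 ≤ n) (δ lam : ℝ)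
    (hδ : ∀ l : ℕ, 1 ≤ l → l ≤ k → δ ≠ 1 + (2 * (k : ℝ) - (l : ℝ) - 1) / ((n : ℝ) + 1))
    (c : ℕ → ℝ) (hc0 : c 0 = 1)
    (hc : ∀ m : ℕ, 1 ≤ m → m ≤ k →
      c m = (-(((k : ℝ) - (m : ℝ)) + lam * ((n : ℝ) + 1))
          / ((m : ℝ) * (-2 * (k : ℝ) + (m : ℝ) + 1 + (δ - 1) * ((n : ℝ) + 1)))) * c (m - 1)) :
    IsProjEquivQuant n k δ lam (∑ m ∈ Finset.range (k + 1), c m • divOp n ^ m) ∧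
    ∀ Φ' : Module.End ℝ (PolySym n), IsProjEquivQuant n k δ lam Φ' →
      ∀ P : PolySym n, IsPHomog n P k →
        Φ' P = (∑ m ∈ Finset.range (k + 1), c m • divOp n ^ m) P := by
  have hn1 : ((n : ℝ) + 1) ≠ 0 := by positivity
  have hd : ∀ m : ℕ, 1 ≤ m → m ≤ k → -2 * (k : ℝ) + m + 1 + (δ - 1) * (n + 1) ≠ 0 := by
    intro m h1 h2 h0
    apply hδ m h1 h2
    field_simp
    linarith
  have hQ := Q_isProjEquivQuant n k δ lam hd c hc0 hc
  refine ⟨hQ, fun Φ' hΦ P hP => ?_⟩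
  obtain ⟨hQ1, hQ2, hQ3⟩ := (isProjEquivQuant_iff' n k δ lam _).mp hQ
  obtain ⟨hF1, hF2, hF3⟩ := (isProjEquivQuant_iff' n k δ lam _).mp hΦ
  set Q : Module.End ℝ (PolySym n) := ∑ m ∈ Finset.range (k + 1), c m • divOp n ^ m with hQdef
  rw [← sub_eq_zero, ← LinearMap.sub_apply]
  refine uniq_zero δ lam k hd _ ?_ (casimir_rel δ lam k (Φ' - Q) ?_ ?_ ?_ P hP)
  · intro t ht
    have e1 := hQ1 P hP t ht
    have e2 := hF1 P hP t ht
    rw [coeff_sub] at e1 e2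
    rw [LinearMap.sub_apply, coeff_sub]
    linarith
  · intro b R hR
    rw [LinearMap.sub_apply, LinearMap.sub_apply, hF2 _ (cVF_affine b) R hR,
      hQ2 _ (cVF_affine b) R hR, map_sub]
  · intro a b R hR
    rw [LinearMap.sub_apply, LinearMap.sub_apply, hF2 _ (lVF_affine a b) R hR,
      hQ2 _ (lVF_affine a b) R hR, map_sub]
  · intro i R hR
    rw [LinearMap.sub_apply, LinearMap.sub_apply, hF3 i R hR, hQ3 i R hR, map_sub, Tcor_sub]
    ring
end
end

section
/- Restricted to weight-δ symbols homogeneous of degree k in p in ker T, the g-th power of the conformal gradient G_0 (gradient G = η^{ij}p_i∂_{x^j} corestricted to ker T via the projection π_0) satisfies [G_0^g, L^*_{X_i}] = -2g(nδ + g - 1)·π_0 p_i·G_0^{g-1}, where L^*_{X_i} denotes the appropriate weight-shifted actions (shift 2/n per application of G_0) and π_0 is the projection onto ker T. -/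
open MvPolynomial

noncomputable section

/-- The trace operator `T = η_{ij} ∂_{p_i} ∂_{p_j}` for the diagonal metric with entries `ε`. -/
def traceOp (n : ℕ) (ε : Fin n → ℝ) : Module.End ℝ (PolySym n) :=
  ∑ i, ε i • (dpOp n i ∘ₗ dpOp n i)

/-- The Euler operator `E = p_i ∂_{p_i}`. -/
def eulerOp (n : ℕ) : Module.End ℝ (PolySym n) := ∑ i, mulOp n (pVar n i) ∘ₗ dpOp n i

/-- The quadratic symbol `R = η^{ij} p_i p_j` (the metric). -/
def rQuad (n : ℕ) (ε : Fin n → ℝ) : PolySym n := ∑ i, ε i • (pVar n i * pVar n i)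

/-- Multiplication by the metric symbol `R`. -/
def rOp (n : ℕ) (ε : Fin n → ℝ) : Module.End ℝ (PolySym n) := mulOp n (rQuad n ε)

/-- The gradient operator `G = η^{ij} p_i ∂_{x^j}`. -/
def gradOp (n : ℕ) (ε : Fin n → ℝ) : Module.End ℝ (PolySym n) :=
  ∑ i, ε i • (mulOp n (pVar n i) ∘ₗ dxOp n i)

/-- The translation vector field `∂_i`. -/
def transVF (n : ℕ) (i : Fin n) : PolyVF n := fun j => if j = i then 1 else 0

/-- The dilation vector field `x^i ∂_i`. -/
def dilVF (n : ℕ) : PolyVF n := fun j => X j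

/-- The rotation vector field `x_j ∂_i - x_i ∂_j` for the diagonal metric `ε`. -/
def rotVF (n : ℕ) (ε : Fin n → ℝ) (i j : Fin n) : PolyVF n :=
  fun m => (if m = i then ε j • X j else 0) - (if m = j then ε i • X i else 0)

/-- The conformal inversion `X_i = x_j x^j ∂_i - 2 x_i x^j ∂_j`. -/
def invVF (n : ℕ) (ε : Fin n → ℝ) (i : Fin n) : PolyVF n :=
  fun j => (if j = i then ∑ m, ε m • (X m * X m) else 0) - (2 * ε i) • (X i * X j)

/-- Generators of the conformal Lie algebra: translations, rotations, the dilation and the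
conformal inversions. -/
def confGenSet (n : ℕ) (ε : Fin n → ℝ) : Set (PolyVF n) :=
  Set.range (transVF n) ∪ {Xf | ∃ i j, Xf = rotVF n ε i j} ∪ {dilVF n} ∪
    Set.range (invVF n ε)


/-- Fischer form -/
def fischer (σ : Type) [Fintype σ] : MvPolynomial σ ℝ →ₗ[ℝ] MvPolynomial σ ℝ →ₗ[ℝ] ℝ :=
  (basisMonomials σ ℝ).constr ℝ (fun m => ((∏ i, (m i).factorial : ℕ) : ℝ) • lcoeff ℝ m)

lemma fischer_monomial (σ : Type) [Fintype σ] (m : σ →₀ ℕ) (a : ℝ) (Q : MvPolynomial σ ℝ) :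
    fischer σ (monomial m a) Q = a * (((∏ i, (m i).factorial : ℕ) : ℝ) * coeff m Q) := by
  have h : (monomial m a : MvPolynomial σ ℝ) = a • basisMonomials σ ℝ m := by
    simp [smul_monomial]
  rw [h, map_smul, fischer, Module.Basis.constr_basis]
  simp [lcoeff_apply]

lemma coeff_pderiv' {σ : Type} [Fintype σ] (i : σ) (m : σ →₀ ℕ) (Q : MvPolynomial σ ℝ) :
    coeff m (pderiv i Q) = ((m i : ℝ) + 1) * coeff (m + Finsupp.single i 1) Q := by
  classical
  induction Q using MvPolynomial.induction_on' with
  | add p q hp hq => simp [hp, hq, mul_add]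
  | monomial u a =>
    rw [pderiv_monomial, coeff_monomial, coeff_monomial]
    by_cases h : u = m + Finsupp.single i 1
    · subst h
      simp [mul_comm]
    · rw [if_neg h, mul_zero]
      by_cases h0 : u i = 0
      · simp [h0]
      · rw [if_neg]
        rintro rfl
        apply h
        ext j
        by_cases hj : j = i
        · subst hj; simp; omega
        · simp [Finsupp.single_apply, Ne.symm hj]

lemma fischer_X_mul (σ : Type) [Fintype σ] (i : σ) (P Q : MvPolynomial σ ℝ) :
    fischer σ (X i * P) Q = fischer σ P (pderiv i Q) := by
  classical
  induction P using MvPolynomial.induction_on' with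
  | add p q hp hq => simp [mul_add, hp, hq]
  | monomial u a =>
    rw [X, monomial_mul, fischer_monomial, fischer_monomial, coeff_pderiv', add_comm u]
    have : (∏ j, ((Finsupp.single i 1 + u : σ →₀ ℕ) j).factorial) = (u i + 1) * ∏ j, (u j).factorial := by
      rw [← Finset.mul_prod_erase _ _ (Finset.mem_univ i),
        ← Finset.mul_prod_erase _ (fun j => (u j).factorial) (Finset.mem_univ i), ← mul_assoc]
      congr 1
      · simp [add_comm 1, Nat.factorial_succ]
      · apply Finset.prod_congr rfl
        intro j hj
        simp [Finsupp.single_apply, Ne.symm (Finset.ne_of_mem_erase hj)]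
    rw [this]
    push_cast
    ring

lemma fischer_self (σ : Type) [Fintype σ] (P : MvPolynomial σ ℝ) (h : fischer σ P P = 0) :
    P = 0 := by
  have key : ∀ Q : MvPolynomial σ ℝ, fischer σ P Q =
      ∑ m ∈ P.support, coeff m P * (((∏ i, (m i).factorial : ℕ) : ℝ) * coeff m Q) := by
    intro Q
    conv_lhs => rw [P.as_sum]
    simp only [map_sum, LinearMap.sum_apply, fischer_monomial]
  rw [key, Finset.sum_eq_zero_iff_of_nonneg] at h
  · ext m
    by_cases hm : m ∈ P.support
    · have := h m hm
      have h1 : ((∏ i, (m i).factorial : ℕ) : ℝ) ≠ 0 := by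
        exact_mod_cast Finset.prod_ne_zero_iff.2 (fun i _ => Nat.factorial_ne_zero _)
      rcases mul_eq_zero.1 this with h2 | h2
      · simpa using h2
      · simpa using (mul_eq_zero.1 h2).resolve_left h1
    · simpa using hm
  · intro m _
    have h1 : (0 : ℝ) ≤ ((∏ i, (m i).factorial : ℕ) : ℝ) := Nat.cast_nonneg _
    nlinarith [mul_nonneg h1 (mul_self_nonneg (coeff m P))]

lemma ker_inter (n : ℕ) (ε : Fin n → ℝ) (Q : PolySym n) (h : traceOp n ε (rQuad n ε * Q) = 0) :
    rQuad n ε * Q = 0 := by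
  apply fischer_self
  have adj : ∀ A B : PolySym n, fischer _ (rQuad n ε * A) B = fischer _ A (traceOp n ε B) := by
    intro A B
    simp only [rQuad, traceOp, pVar, dpOp, Finset.sum_mul, map_sum, LinearMap.sum_apply,
      smul_mul_assoc, mul_assoc, map_smul, LinearMap.smul_apply, fischer_X_mul,
      LinearMap.comp_apply]
    rfl
  rw [adj, h, map_zero]

lemma der_sum_apply {ι : Type} (s : Finset ι) {σ : Type} (D : ι → Derivation ℝ (MvPolynomial σ ℝ) (MvPolynomial σ ℝ))
    (P : MvPolynomial σ ℝ) : (∑ j ∈ s, D j) P = ∑ j ∈ s, D j P := by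
  classical
  induction s using Finset.induction_on with
  | empty => simp
  | insert a s ha ih => simp [Finset.sum_insert ha, ih]

/-- first-order part of the action of `X_i` -/
def invDer (n : ℕ) (ε : Fin n → ℝ) (i : Fin n) : Derivation ℝ (PolySym n) (PolySym n) :=
  (∑ j, liftX n (invVF n ε i j) • pderiv (Sum.inl j))
    - ∑ a, ∑ j, (pVar n j * liftX n (pderiv a (invVF n ε i j))) • pderiv (Sum.inr a)

def gradDer (n : ℕ) (ε : Fin n → ℝ) : Derivation ℝ (PolySym n) (PolySym n) :=
  ∑ j, (ε j • pVar n j) • pderiv (Sum.inl j)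

lemma gradOp_apply (n : ℕ) (ε : Fin n → ℝ) (P : PolySym n) : gradOp n ε P = gradDer n ε P := by
  simp [gradOp, gradDer, mulOp, dxOp, der_sum_apply]

lemma div_inv (n : ℕ) (ε : Fin n → ℝ) (i : Fin n) :
    liftX n (divVF n (invVF n ε i)) = C (-2 * n * ε i) * xVar n i := by
  classical
  have : divVF n (invVF n ε i) = C (-2 * n * ε i) * X i := by
    simp only [divVF, invVF, map_sub, apply_ite (pderiv _), map_zero, map_sum, map_smul, smul_eq_C_mul,
      Derivation.leibniz, pderiv_C, pderiv_X, Pi.single_apply, smul_eq_mul, Finset.sum_sub_distrib,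
      Finset.sum_ite_eq, Finset.mem_univ, Finset.sum_add_distrib, mul_add, mul_ite, mul_one, mul_zero,
      Finset.sum_ite_eq', if_true, Finset.sum_const_zero, add_zero, Finset.sum_const, Finset.card_univ, Fintype.card_fin, nsmul_eq_mul]
    simp only [map_mul, map_neg, map_natCast, map_ofNat]
    ring
  rw [this]; simp [liftX, xVar]

lemma Lop_apply_s14 (n : ℕ) (ε : Fin n → ℝ) (i : Fin n) (δ : ℝ) (P : PolySym n) :
    Lop n δ (invVF n ε i) P = invDer n ε i P + C (-2 * n * δ * ε i) * (xVar n i * P) := by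
  simp only [Lop, LinearMap.add_apply, LinearMap.sub_apply, LinearMap.smul_apply, mulOp, div_inv, invDer,
    LinearMap.mulLeft_apply, smul_eq_C_mul]
  congr 1
  · simp [dxOp, dpOp, der_sum_apply, mul_assoc]
  · simp only [map_mul, map_neg]; ring

lemma invDer_x (n : ℕ) (ε : Fin n → ℝ) (i j : Fin n) :
    invDer n ε i (X (Sum.inl j)) =
      (if j = i then ∑ m, C (ε m) * (xVar n m * xVar n m) else 0)
        - C (2 * ε i) * (xVar n i * xVar n j) := by
  classical
  simp only [invDer, Derivation.sub_apply, der_sum_apply, Derivation.smul_apply,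
    pderiv_X, Pi.single_apply, smul_eq_mul, Sum.inl.injEq, reduceCtorEq, if_false, mul_zero,
    Finset.sum_const_zero, sub_zero, mul_ite, mul_one, Finset.sum_ite_eq, Finset.mem_univ, if_true,
    invVF, liftX, map_sub, apply_ite (rename _), map_zero, map_sum, smul_eq_C_mul, map_mul, rename_C,
    rename_X, xVar]

lemma invDer_p (n : ℕ) (ε : Fin n → ℝ) (i j : Fin n) :
    invDer n ε i (X (Sum.inr j)) =
      - C (2 * ε j) * (xVar n j * pVar n i)
      + (if j = i then C (2 * ε i) * ∑ m, xVar n m * pVar n m else 0)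
        + C (2 * ε i) * (xVar n i * pVar n j) := by
  classical
  simp only [invDer, Derivation.sub_apply, der_sum_apply, Derivation.smul_apply,
    pderiv_X, Pi.single_apply, smul_eq_mul, Sum.inr.injEq, reduceCtorEq, if_false, mul_zero,
    Finset.sum_const_zero, zero_sub, mul_ite, mul_one, Finset.sum_ite_irrel, Finset.sum_ite_eq, Finset.mem_univ, if_true]
  have : ∀ m, liftX n (pderiv j (invVF n ε i m)) =
     (if m = i then C (2 * ε j) * xVar n j else 0) - (if j = i then C (2 * ε i) * xVar n m else 0)
       - (if m = j then C (2 * ε i) * xVar n i else 0) := by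
    intro m
    simp only [invVF, map_sub, apply_ite (pderiv _), map_zero, map_sum, map_smul, smul_eq_C_mul,
      Derivation.leibniz, pderiv_C, pderiv_X, Pi.single_apply, smul_eq_mul, mul_add, mul_ite, mul_one, mul_zero,
      Finset.sum_add_distrib, Finset.sum_ite_eq', Finset.sum_ite_eq, Finset.mem_univ, if_true, Finset.sum_const_zero, add_zero]
    simp only [liftX, xVar, map_sub, map_zero,
      apply_ite (rename _), map_add, map_mul, rename_C, rename_X, map_ofNat]
    simp only [eq_comm (a := i) (b := j)]
    split_ifs <;> ring
  simp only [this, mul_sub, Finset.sum_sub_distrib, mul_ite, mul_zero, Finset.sum_ite_eq', Finset.mem_univ,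
    if_true]
  split_ifs
  · simp only [Finset.mul_sum]
    simp only [mul_left_comm (pVar n _), mul_comm (pVar n _)]
    ring
  · simp; ring

lemma gradDer_x (n : ℕ) (ε : Fin n → ℝ) (j : Fin n) :
    gradDer n ε (X (Sum.inl j)) = C (ε j) * pVar n j := by
  classical
  simp [gradDer, der_sum_apply, pderiv_X, Pi.single_apply, smul_eq_C_mul]

lemma gradDer_p (n : ℕ) (ε : Fin n → ℝ) (j : Fin n) :
    gradDer n ε (X (Sum.inr j)) = 0 := by
  classical
  simp [gradDer, der_sum_apply, pderiv_X, Pi.single_apply]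

lemma der_C {σ : Type} (D : Derivation ℝ (MvPolynomial σ ℝ) (MvPolynomial σ ℝ)) (a : ℝ) :
    D (C a) = 0 := by
  rw [← algebraMap_eq]; simp

lemma C_sq (n : ℕ) (ε : Fin n → ℝ) (hε : ∀ i, ε i = 1 ∨ ε i = -1) (i : Fin n) :
    (C (ε i) * C (ε i) : PolySym n) = 1 := by
  rw [← C_mul]; rcases hε i with h | h <;> simp [h]

lemma rQuad_eq (n : ℕ) (ε : Fin n → ℝ) :
    rQuad n ε = ∑ m, C (ε m) * (pVar n m * pVar n m) := by
  simp [rQuad, smul_eq_C_mul]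

lemma comm_grad (n : ℕ) (ε : Fin n → ℝ) (hε : ∀ i, ε i = 1 ∨ ε i = -1) (i : Fin n) (P : PolySym n) :
    gradDer n ε (invDer n ε i P) - invDer n ε i (gradDer n ε P) =
      C (-4 * ε i) * xVar n i * gradDer n ε P
        + rQuad n ε * (C (2 * ε i) * pderiv (Sum.inr i) P) := by
  classical
  have key : ⁅gradDer n ε, invDer n ε i⁆ = (C (-4 * ε i) * xVar n i) • gradDer n ε
      + (rQuad n ε * C (2 * ε i)) • (pderiv (Sum.inr i) : Derivation ℝ (PolySym n) (PolySym n)) := by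
    apply derivation_ext
    have h1 : ∀ m, gradDer n ε (xVar n m) = C (ε m) * pVar n m := gradDer_x n ε
    have h2 : ∀ m, gradDer n ε (pVar n m) = 0 := gradDer_p n ε
    have h3 : ∀ m, invDer n ε i (pVar n m) = _ := invDer_p n ε i
    have hi := C_sq n ε hε i
    rintro (j | j)
    · have hj := C_sq n ε hε j
      rw [Derivation.commutator_apply, invDer_x, gradDer_x]
      simp only [Derivation.leibniz, der_C, h3, smul_eq_mul, mul_zero, add_zero, map_sub, apply_ite (gradDer n ε),
        map_sum, map_zero, h1, Derivation.add_apply, Derivation.smul_apply, pderiv_X, Pi.single_apply,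
        reduceCtorEq, if_false, gradDer_x]
      have e : ∀ m, (C (ε m) * (xVar n m * (C (ε m) * pVar n m) + xVar n m * (C (ε m) * pVar n m)) : PolySym n)
          = 2 * (xVar n m * pVar n m) := by
        intro m
        linear_combination (2 * (xVar n m * pVar n m)) * C_sq n ε hε m
      simp only [e, ← Finset.mul_sum]
      simp only [map_mul, map_neg, map_ofNat]
      split_ifs with h
      · subst h
        linear_combination (2 * pVar n j * xVar n j - 2 * ∑ m, xVar n m * pVar n m - 2 * xVar n j * pVar n j) * hj
      · linear_combination (2 * pVar n i * xVar n j) * hj - (2 * pVar n i * xVar n j) * hi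
    · have hj := C_sq n ε hε j
      rw [Derivation.commutator_apply, invDer_p, gradDer_p]
      simp only [Derivation.leibniz, der_C, h2, smul_eq_mul, mul_zero, add_zero, zero_add, map_sub, map_add, map_neg, neg_mul,
        apply_ite (gradDer n ε),
        map_sum, map_zero, h1, Derivation.add_apply, Derivation.smul_apply, pderiv_X, Pi.single_apply,
        Sum.inr.injEq, gradDer_p]
      have e : ∑ m, pVar n m * (C (ε m) * pVar n m) = rQuad n ε := by
        rw [rQuad_eq]; exact Finset.sum_congr rfl (fun m _ => by ring)
      rw [e]
      simp only [map_mul, map_neg, map_ofNat]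
      split_ifs with h
      · subst h
        ring
      · linear_combination (2 * pVar n i * pVar n j) * hi - (2 * pVar n i * pVar n j) * hj
  have := congrArg (fun D : Derivation ℝ (PolySym n) (PolySym n) => D P) key
  simpa only [Derivation.commutator_apply, Derivation.add_apply, Derivation.smul_apply, smul_eq_mul,
    mul_assoc] using this

lemma invDer_R (n : ℕ) (ε : Fin n → ℝ) (hε : ∀ i, ε i = 1 ∨ ε i = -1) (i : Fin n) :
    invDer n ε i (rQuad n ε) = rQuad n ε * (C (4 * ε i) * xVar n i) := by
  classical
  have h3 : ∀ m, invDer n ε i (pVar n m) = _ := invDer_p n ε i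
  rw [rQuad_eq]
  simp only [map_sum, Derivation.leibniz, der_C, h3, smul_eq_mul, mul_zero, add_zero]
  have e : ∀ m, C (ε m) * (pVar n m * (-C (2 * ε m) * (xVar n m * pVar n i)
      + (if m = i then C (2 * ε i) * ∑ m, xVar n m * pVar n m else 0) + C (2 * ε i) * (xVar n i * pVar n m))
      + pVar n m * (-C (2 * ε m) * (xVar n m * pVar n i)
      + (if m = i then C (2 * ε i) * ∑ m, xVar n m * pVar n m else 0) + C (2 * ε i) * (xVar n i * pVar n m)))
      = -4 * pVar n i * (xVar n m * pVar n m) + (if m = i then 4 * pVar n i * ∑ m, xVar n m * pVar n m else 0)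
        + C (ε m) * (pVar n m * pVar n m) * (C (4 * ε i) * xVar n i) := by
    intro m
    have hm := C_sq n ε hε m
    simp only [map_mul, map_ofNat]
    split_ifs with h
    · subst h
      linear_combination (-4 * xVar n m * pVar n m * pVar n m
        + 4 * pVar n m * ∑ m, xVar n m * pVar n m) * hm
    · linear_combination (-4 * xVar n m * pVar n m * pVar n i) * hm
  simp only [e, Finset.sum_add_distrib, ← Finset.mul_sum, Finset.sum_ite_eq', Finset.mem_univ, if_true,
    ← Finset.sum_mul]
  ring

lemma pd_comm {σ : Type} (a b : σ) (P : MvPolynomial σ ℝ) :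
    pderiv a (pderiv b P) = pderiv b (pderiv a P) := by
  classical
  have key : ⁅(pderiv a : Derivation ℝ (MvPolynomial σ ℝ) (MvPolynomial σ ℝ)),
      (pderiv b : Derivation ℝ (MvPolynomial σ ℝ) (MvPolynomial σ ℝ))⁆ = 0 := by
    apply derivation_ext
    intro j
    rw [Derivation.commutator_apply, pderiv_X, pderiv_X]
    simp only [Pi.single_apply]
    split_ifs <;> simp
  have := congrArg (fun D : Derivation ℝ (MvPolynomial σ ℝ) (MvPolynomial σ ℝ) => D P) key
  simpa [Derivation.commutator_apply, sub_eq_zero] using this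

lemma comm_dp (n : ℕ) (ε : Fin n → ℝ) (i a : Fin n) (P : PolySym n) :
    pderiv (Sum.inr a) (invDer n ε i P) = invDer n ε i (pderiv (Sum.inr a) P) +
      (C (2 * ε i) * xVar n i * pderiv (Sum.inr a) P + C (2 * ε i) * xVar n a * pderiv (Sum.inr i) P
        - if a = i then ∑ j, C (2 * ε j) * xVar n j * pderiv (Sum.inr j) P else 0) := by
  classical
  have key : ⁅(pderiv (Sum.inr a) : Derivation ℝ (PolySym n) (PolySym n)), invDer n ε i⁆ =
      (C (2 * ε i) * xVar n i) • (pderiv (Sum.inr a) : Derivation ℝ (PolySym n) (PolySym n))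
      + (C (2 * ε i) * xVar n a) • (pderiv (Sum.inr i) : Derivation ℝ (PolySym n) (PolySym n))
      - if a = i then ∑ j, (C (2 * ε j) * xVar n j) •
        (pderiv (Sum.inr j) : Derivation ℝ (PolySym n) (PolySym n)) else 0 := by
    have h1 : ∀ m, pderiv (Sum.inr a) (xVar n m) = 0 := by
      intro m; simp [xVar, pderiv_X]
    have h2 : ∀ m, pderiv (Sum.inr a) (pVar n m) = if m = a then 1 else 0 := by
      intro m; simp [pVar, pderiv_X, Pi.single_apply]
    apply derivation_ext
    rintro (j | j)
    · rw [Derivation.commutator_apply, invDer_x]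
      simp only [Derivation.leibniz, der_C, smul_eq_mul, mul_zero, add_zero, map_sub, apply_ite (pderiv (R := ℝ) (Sum.inr a : Fin n ⊕ Fin n)),
        map_sum, map_zero, h1, Derivation.add_apply, Derivation.sub_apply, Derivation.smul_apply, pderiv_X, Pi.single_apply,
        reduceCtorEq, if_false]
      split_ifs <;> simp [der_sum_apply]
    · rw [Derivation.commutator_apply, invDer_p]
      simp only [Derivation.leibniz, der_C, smul_eq_mul, mul_zero, add_zero, map_sub, map_add, map_neg, neg_mul,
        apply_ite (pderiv (R := ℝ) (Sum.inr a : Fin n ⊕ Fin n)),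
        map_sum, map_zero, h1, h2, Derivation.add_apply, Derivation.sub_apply, Derivation.smul_apply, pderiv_X, Pi.single_apply,
        Sum.inr.injEq, mul_ite, mul_one, Finset.sum_ite_eq', Finset.mem_univ, if_true]
      have e : (if a = i then ∑ j, (C (2 * ε j) * xVar n j) •
        (pderiv (Sum.inr j) : Derivation ℝ (PolySym n) (PolySym n)) else 0) (X (Sum.inr j))
        = if i = a then C (2 * ε j) * xVar n j else 0 := by
        simp only [eq_comm (a := i) (b := a)]
        split_ifs
        · simp [der_sum_apply, pderiv_X, Pi.single_apply]
        · simp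
      rw [e]
      have e2 : invDer n ε i (if j = a then 1 else 0) = 0 := by split_ifs <;> simp
      rw [e2]
      split_ifs <;> ring
  have := congrArg (fun D : Derivation ℝ (PolySym n) (PolySym n) => D P) key
  simp only [Derivation.commutator_apply, Derivation.add_apply, Derivation.sub_apply, Derivation.smul_apply,
    smul_eq_mul] at this
  rw [sub_eq_iff_eq_add'] at this
  rw [this]
  congr 2
  split_ifs <;> simp [der_sum_apply]

lemma trace_apply (n : ℕ) (ε : Fin n → ℝ) (P : PolySym n) :
    traceOp n ε P = ∑ a, C (ε a) * pderiv (Sum.inr a) (pderiv (Sum.inr a) P) := by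
  simp [traceOp, dpOp, smul_eq_C_mul]

lemma pd_x (n : ℕ) (a m : Fin n) : pderiv (Sum.inr a) (xVar n m) = 0 := by
  classical
  simp [xVar, pderiv_X]

lemma trace_invDer (n : ℕ) (ε : Fin n → ℝ) (i : Fin n) (P : PolySym n) :
    traceOp n ε (invDer n ε i P) = invDer n ε i (traceOp n ε P)
      + C (4 * ε i) * xVar n i * traceOp n ε P := by
  classical
  simp only [trace_apply, comm_dp, map_add, map_sub, Derivation.leibniz, der_C, pd_x, smul_eq_mul, mul_zero,
    add_zero, map_sum, apply_ite (pderiv (R := ℝ) (Sum.inr _ : Fin n ⊕ Fin n)), map_zero, Finset.mul_sum,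
    ← Finset.sum_add_distrib]
  have e : ∀ a, (C (ε a) * (invDer n ε i (pderiv (Sum.inr a) (pderiv (Sum.inr a) P)) +
      (C (2 * ε i) * xVar n i * pderiv (Sum.inr a) (pderiv (Sum.inr a) P)
        + C (2 * ε i) * xVar n a * pderiv (Sum.inr i) (pderiv (Sum.inr a) P)
        - if a = i then ∑ j, C (2 * ε j) * xVar n j * pderiv (Sum.inr j) (pderiv (Sum.inr a) P) else 0)
      + (C (2 * ε i) * xVar n i * pderiv (Sum.inr a) (pderiv (Sum.inr a) P)
        + C (2 * ε i) * xVar n a * pderiv (Sum.inr a) (pderiv (Sum.inr i) P)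
        - if a = i then ∑ j, C (2 * ε j) * xVar n j * pderiv (Sum.inr a) (pderiv (Sum.inr j) P) else 0)) : PolySym n)
      = C (ε a) * invDer n ε i (pderiv (Sum.inr a) (pderiv (Sum.inr a) P))
        + C (4 * ε i) * xVar n i * (C (ε a) * pderiv (Sum.inr a) (pderiv (Sum.inr a) P))
        + (C (2 * ε i) * (C (2 * ε a) * xVar n a * pderiv (Sum.inr i) (pderiv (Sum.inr a) P))
          - if a = i then C (2 * ε i) * ∑ j, C (2 * ε j) * xVar n j * pderiv (Sum.inr i) (pderiv (Sum.inr j) P)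
            else 0) := by
    intro a
    rw [pd_comm (Sum.inr a) (Sum.inr i)]
    split_ifs with h
    · subst h
      simp only [pd_comm _ (Sum.inr a)]
      simp only [map_mul, map_ofNat]
      ring
    · simp only [map_mul, map_ofNat]
      ring
  trans
  · exact Finset.sum_congr rfl (fun a _ => by convert e a using 3 <;> ring)
  rw [Finset.sum_add_distrib, Finset.sum_sub_distrib, ← Finset.mul_sum]
  simp
/-- Let `π_0` be the projection onto `ker T` along the image of
multiplication by `R`, and `G_0 = π_0 ∘ G` the traceless gradient. On weight-`δ` symbols
homogeneous of degree `k` in `p` and lying in `ker T`, the `g`-th power of `G_0` satisfies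
`[G_0^g, L^*_{X_i}] = -2g(nδ + g - 1) π_0 p_i G_0^{g-1}`, where `L^*` denotes the
weight-shifted actions (shift `2/n` per application of `G_0`). -/
theorem gradOp_pow_commutator_conformal (n k g : ℕ) (hn : 1 ≤ n) (hg : 1 ≤ g) (δ : ℝ)
    (ε : Fin n → ℝ) (hε : ∀ i, ε i = 1 ∨ ε i = -1) (π0 : Module.End ℝ (PolySym n))
    (hπ1 : ∀ P : PolySym n, traceOp n ε (π0 P) = 0)
    (hπ2 : ∀ P : PolySym n, ∃ Q : PolySym n, P - π0 P = rQuad n ε * Q)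
    (i : Fin n) (P : PolySym n) (hP : IsPHomog n P k) (hT : traceOp n ε P = 0) :
    ((π0 ∘ₗ gradOp n ε) ^ g) (Lop n δ (invVF n ε i) P)
        - Lop n (δ + 2 * (g : ℝ) / (n : ℝ)) (invVF n ε i) (((π0 ∘ₗ gradOp n ε) ^ g) P)
      = (-(2 * (g : ℝ)) * ((n : ℝ) * δ + (g : ℝ) - 1)) •
          π0 (pVar n i * ((π0 ∘ₗ gradOp n ε) ^ (g - 1)) P) := by
  obtain ⟨g, rfl⟩ : ∃ m, g = m + 1 := ⟨g - 1, by omega⟩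
  have hn0 : (n : ℝ) ≠ 0 := by exact_mod_cast (by omega : n ≠ 0)
  have hR : ∀ Q, π0 (rQuad n ε * Q) = 0 := by
    intro Q
    obtain ⟨Q', h⟩ := hπ2 (rQuad n ε * Q)
    have e : π0 (rQuad n ε * Q) = rQuad n ε * (Q - Q') := by
      rw [mul_sub, ← h]; ring
    rw [e]
    apply ker_inter
    rw [← e]
    exact hπ1 _
  have hid : ∀ A, traceOp n ε A = 0 → π0 A = A := by
    intro A hA
    obtain ⟨Q, h⟩ := hπ2 A
    have h2 : rQuad n ε * Q = 0 := by
      apply ker_inter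
      rw [← h, map_sub, hA, hπ1, sub_zero]
    rw [h2, sub_eq_zero] at h
    exact h.symm
  have hG : ∀ A, π0 (gradOp n ε (π0 A)) = π0 (gradOp n ε A) := by
    intro A
    obtain ⟨Q, h⟩ := hπ2 A
    have hA : A = π0 A + rQuad n ε * Q := by rw [← h]; ring
    have hr : gradDer n ε (rQuad n ε) = 0 := by
      have h2 : ∀ m, gradDer n ε (pVar n m) = 0 := gradDer_p n ε
      rw [rQuad_eq]
      simp [Derivation.leibniz, der_C, h2]
    conv_rhs => rw [hA, map_add, map_add, gradOp_apply n ε (rQuad n ε * Q), Derivation.leibniz, hr,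
      smul_zero, add_zero, smul_eq_mul, hR, add_zero]
  have hp : ∀ A, π0 (pVar n i * π0 A) = π0 (pVar n i * A) := by
    intro A
    obtain ⟨Q, h⟩ := hπ2 A
    have hA : A = π0 A + rQuad n ε * Q := by rw [← h]; ring
    conv_rhs => rw [hA, mul_add, map_add, mul_left_comm, hR, add_zero]
  have hL : ∀ d A, Lop n d (invVF n ε i) (π0 A) = π0 (Lop n d (invVF n ε i) A) := by
    intro d A
    obtain ⟨Q, h⟩ := hπ2 A
    have hA : A = π0 A + rQuad n ε * Q := by rw [← h]; ring
    have e1 : Lop n d (invVF n ε i) (rQuad n ε * Q) = rQuad n ε * (invDer n ε i Q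
        + C (4 * ε i) * xVar n i * Q + C (-2 * n * d * ε i) * (xVar n i * Q)) := by
      rw [Lop_apply_s14, Derivation.leibniz, invDer_R n ε hε, smul_eq_mul, smul_eq_mul]
      ring
    conv_rhs => rw [hA, map_add, map_add, e1, hR, add_zero]
    symm
    apply hid
    rw [Lop_apply_s14, map_add, trace_invDer, hπ1]
    have e2 : ∀ c : ℝ, traceOp n ε (C c * (xVar n i * π0 A)) = C c * (xVar n i * traceOp n ε (π0 A)) := by
      intro c
      simp only [trace_apply, Derivation.leibniz, der_C, pd_x, smul_eq_mul, mul_zero, add_zero, Finset.mul_sum]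
      exact Finset.sum_congr rfl (fun a _ => by ring)
    rw [e2, hπ1]
    simp
  have step : ∀ d A, π0 (gradOp n ε (Lop n d (invVF n ε i) A)) =
      Lop n (d + 2 / n) (invVF n ε i) (π0 (gradOp n ε A)) + (-2 * (n * d)) • π0 (pVar n i * A) := by
    intro d A
    have h1 : gradDer n ε (xVar n i) = C (ε i) * pVar n i := gradDer_x n ε i
    have hi := C_sq n ε hε i
    have e : gradOp n ε (Lop n d (invVF n ε i) A) = Lop n (d + 2 / n) (invVF n ε i) (gradOp n ε A)
        + (-2 * (n * d)) • (pVar n i * A)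
        + rQuad n ε * (C (2 * ε i) * pderiv (Sum.inr i) A) := by
      have hc := comm_grad n ε hε i A
      have h5 : -2 * (n : ℝ) * (d + 2 / n) * ε i = -2 * n * d * ε i + -4 * ε i := by
        field_simp; ring
      rw [Lop_apply_s14, Lop_apply_s14, gradOp_apply, gradOp_apply, h5]
      simp only [map_add, Derivation.leibniz, der_C, h1, smul_eq_mul, mul_zero, add_zero, smul_eq_C_mul]
      simp only [map_mul, map_neg, map_ofNat] at hc ⊢
      linear_combination hc + (-2 * C (n : ℝ) * C d * pVar n i * A) * hi
    rw [e, map_add, map_add, hR, add_zero, hL, map_smul]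
  induction g with
  | zero =>
    simp only [zero_add, pow_one, LinearMap.comp_apply, step, Nat.sub_self, pow_zero, Module.End.one_apply,
      Nat.cast_one, mul_one, add_sub_cancel_left, add_sub_cancel_right]
    try (congr 1; ring)
  | succ g ih =>
    have ih' := ih (by omega)
    rw [sub_eq_iff_eq_add'] at ih'
    simp only [Nat.add_sub_cancel] at ih' ⊢
    rw [pow_succ' _ (g + 1), Module.End.mul_apply, Module.End.mul_apply, ih', map_add, map_smul]
    simp only [LinearMap.comp_apply]
    have h3 : ∀ A, π0 (gradOp n ε (π0 (pVar n i * A))) = π0 (pVar n i * π0 (gradOp n ε A)) := by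
      intro A
      have h2 : gradDer n ε (pVar n i) = 0 := gradDer_p n ε i
      rw [hG, hp, gradOp_apply, gradOp_apply, Derivation.leibniz, h2]
      simp
    have h4 : δ + 2 * ((g + 1 : ℕ) : ℝ) / n + 2 / n = δ + 2 * ((g + 1 + 1 : ℕ) : ℝ) / n := by
      push_cast; ring
    rw [step, h3, h4, pow_succ' _ g, Module.End.mul_apply, LinearMap.comp_apply, add_assoc,
      add_sub_cancel_left, ← add_smul]
    have h6 : (n : ℝ) * (δ + 2 * ((g + 1 : ℕ) : ℝ) / n) = n * δ + 2 * ((g + 1 : ℕ) : ℝ) := by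
      field_simp
    rw [h6]
    congr 1
    push_cast
    ring
end
end
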